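/- Assume that for every degree m ≤ n, every GC_m set possesses a maximal line (the GM conjecture up to degree n). Let X be a GC_n set with μ(X) maximal lines. Then μ(X) ∈ {3, n−1, n, n+1, n+2}. -/

import Mathlib

open MvPolynomial

/-- Bivariate real polynomials. -/
abbrev Poly2 : Type := MvPolynomial (Fin 2) ℝ

/-- Evaluation of a bivariate polynomial at a point of `ℝ²`. -/
noncomputable def evalPt (p : Poly2) (A : ℝ × ℝ) : ℝ :=
  MvPolynomial.eval (fun i => if i = 0 then A.1 else A.2) p

/-- `X` is an `n`-poised set: it has `(n+2 choose 2)` nodes and the only polynomial of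
total degree at most `n` vanishing on all of `X` is the zero polynomial. -/
def IsPoised (n : ℕ) (X : Finset (ℝ × ℝ)) : Prop :=
  X.card = (n + 2).choose 2 ∧
    ∀ p : Poly2, p.totalDegree ≤ n → (∀ A ∈ X, evalPt p A = 0) → p = 0

/-- `p` is an `n`-fundamental polynomial of the node `A` with respect to `X`. -/
def IsFund (n : ℕ) (X : Finset (ℝ × ℝ)) (A : ℝ × ℝ) (p : Poly2) : Prop :=
  p.totalDegree ≤ n ∧ evalPt p A = 1 ∧ ∀ B ∈ X, B ≠ A → evalPt p B = 0

/-- `X` is a `GC_n` set: `n`-poised and each node has a fundamental polynomial which is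
a product of `n` polynomials of degree 1. -/
def IsGC (n : ℕ) (X : Finset (ℝ × ℝ)) : Prop :=
  IsPoised n X ∧
    ∀ A ∈ X, ∃ p : Poly2, IsFund n X A p ∧
      ∃ f : Fin n → Poly2, (∀ i, (f i).totalDegree = 1) ∧ p = ∏ i, f i

/-- The nodes of `X` lying on the zero set of `ℓ`. -/
noncomputable def nodesOn (X : Finset (ℝ × ℝ)) (ℓ : Poly2) : Finset (ℝ × ℝ) :=
  @Finset.filter _ (fun A => evalPt ℓ A = 0) (Classical.decPred _) X

/-- `ℓ` is a `k`-node line of `X`: it has degree exactly 1 and passes through exactly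
`k` nodes of `X`. -/
def IsKNodeLine (X : Finset (ℝ × ℝ)) (ℓ : Poly2) (k : ℕ) : Prop :=
  ℓ.totalDegree = 1 ∧ (nodesOn X ℓ).card = k

/-- A maximal line of an `n`-poised set: an `(n+1)`-node line. -/
def IsMaximalLine (n : ℕ) (X : Finset (ℝ × ℝ)) (ℓ : Poly2) : Prop :=
  IsKNodeLine X ℓ (n + 1)

/-- The zero set of a polynomial, i.e. the line it determines when it has degree 1. -/
def zeroSet (ℓ : Poly2) : Set (ℝ × ℝ) := {A | evalPt ℓ A = 0}

/-- `μ(X)`: the number of maximal lines (as subsets of the plane) of `X`. -/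
noncomputable def mu (n : ℕ) (X : Finset (ℝ × ℝ)) : ℕ :=
  {L : Set (ℝ × ℝ) | ∃ ℓ : Poly2, IsMaximalLine n X ℓ ∧ L = zeroSet ℓ}.ncard

/-- The node `A` of `X` uses the line `ℓ`: `ℓ` divides a fundamental polynomial of `A`. -/
def Uses (n : ℕ) (X : Finset (ℝ × ℝ)) (ℓ : Poly2) (A : ℝ × ℝ) : Prop :=
  ∃ p : Poly2, IsFund n X A p ∧ ℓ ∣ p

/-- `X_ℓ`: the set of nodes of `X` using the line `ℓ`. -/
noncomputable def usesSet (n : ℕ) (X : Finset (ℝ × ℝ)) (ℓ : Poly2) : Finset (ℝ × ℝ) :=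
  @Finset.filter _ (Uses n X ℓ) (Classical.decPred _) X

/-- The Gasca–Maeztu conjecture for degree `m`: every `GC_m` set has a maximal line. -/
def GM (m : ℕ) : Prop :=
  ∀ Y : Finset (ℝ × ℝ), IsGC m Y → ∃ lam : Poly2, IsMaximalLine m Y lam



/-! ### Polynomials along lines -/

/-- The linear polynomial `a x + b y + c`. -/
noncomputable def lnPoly (a b c : ℝ) : Poly2 :=
  MvPolynomial.C a * MvPolynomial.X 0 + MvPolynomial.C b * MvPolynomial.X 1 + MvPolynomial.C c

theorem evalPt_lnPoly (a b c : ℝ) (p : ℝ × ℝ) :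
    evalPt (lnPoly a b c) p = a * p.1 + b * p.2 + c := by
  simp [evalPt, lnPoly]

theorem evalPt_mul (p q : Poly2) (A : ℝ × ℝ) : evalPt (p * q) A = evalPt p A * evalPt q A := by
  simp [evalPt]

theorem evalPt_add (p q : Poly2) (A : ℝ × ℝ) : evalPt (p + q) A = evalPt p A + evalPt q A := by
  simp [evalPt]

theorem evalPt_prod {ι : Type} (s : Finset ι) (f : ι → Poly2) (A : ℝ × ℝ) :
    evalPt (∏ i ∈ s, f i) A = ∏ i ∈ s, evalPt (f i) A := by
  simp [evalPt]

theorem evalPt_C (c : ℝ) (A : ℝ × ℝ) : evalPt (MvPolynomial.C c) A = c := by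
  simp [evalPt]

theorem totalDegree_lnPoly_le (a b c : ℝ) : (lnPoly a b c).totalDegree ≤ 1 := by
  unfold lnPoly
  refine (totalDegree_add _ _).trans (max_le ((totalDegree_add _ _).trans (max_le ?_ ?_)) ?_)
  · exact (totalDegree_mul _ _).trans (by simp)
  · exact (totalDegree_mul _ _).trans (by simp)
  · simp

theorem totalDegree_lnPoly (a b c : ℝ) (h : a ≠ 0 ∨ b ≠ 0) :
    (lnPoly a b c).totalDegree = 1 := by
  refine le_antisymm (totalDegree_lnPoly_le a b c) ?_
  by_contra hlt
  have h0 : (lnPoly a b c).totalDegree = 0 := by omega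
  rw [totalDegree_eq_zero_iff_eq_C] at h0
  have h1 : ∀ p, evalPt (lnPoly a b c) p = coeff 0 (lnPoly a b c) := by
    intro p
    rw [h0, evalPt_C]
    simp
  have e0 := h1 (0, 0)
  have e1 := h1 (1, 0)
  have e2 := h1 (0, 1)
  rw [evalPt_lnPoly] at e0 e1 e2
  simp at e0 e1 e2
  rcases h with h | h
  · apply h; linarith
  · apply h; linarith

theorem eq_lnPoly_of_totalDegree (p : Poly2) (h : p.totalDegree ≤ 1) :
    ∃ a b c, p = lnPoly a b c := by
  refine ⟨coeff (Finsupp.single 0 1) p, coeff (Finsupp.single 1 1) p, coeff 0 p, ?_⟩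
  ext m
  have hm : ∀ m : Fin 2 →₀ ℕ, m = Finsupp.single 0 (m 0) + Finsupp.single 1 (m 1) := by
    intro m
    ext i
    fin_cases i <;> simp
  by_cases hd : 1 < m 0 + m 1
  · have e : ∀ q : Poly2, q.totalDegree ≤ 1 → coeff m q = 0 := by
      intro q hq
      apply coeff_eq_zero_of_totalDegree_lt
      have : ∑ i ∈ m.support, m i = m 0 + m 1 := by
        rw [Finset.sum_subset (Finset.subset_univ _)]
        · simp
        · intro x _ hx
          simpa using hx
      omega
    rw [e _ h, e _ (totalDegree_lnPoly_le _ _ _)]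
  · have h3 : (m 0 = 0 ∧ m 1 = 0) ∨ (m 0 = 1 ∧ m 1 = 0) ∨ (m 0 = 0 ∧ m 1 = 1) := by omega
    have n1 : (Finsupp.single (0 : Fin 2) 1 : Fin 2 →₀ ℕ) ≠ Finsupp.single 1 1 := by
      intro hh
      have := DFunLike.congr_fun hh 0
      simp at this
    rcases h3 with ⟨h0, h1⟩ | ⟨h0, h1⟩ | ⟨h0, h1⟩
    · have := hm m
      rw [h0, h1] at this
      simp at this
      subst this
      simp [lnPoly]
    · have := hm m
      rw [h0, h1] at this
      simp at this
      subst this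
      simp [lnPoly, coeff_X', coeff_C, n1, n1.symm]
      try simp [eq_comm]
    · have := hm m
      rw [h0, h1] at this
      simp at this
      subst this
      simp [lnPoly, coeff_X', coeff_C, n1, n1.symm]
      try simp [eq_comm]

/-- `p` is zero or has total degree less than `k`. -/
def Deg (k : ℕ) (p : Poly2) : Prop := p = 0 ∨ p.totalDegree < k

theorem Deg.combo {k : ℕ} {p q : Poly2} (hp : Deg k p) (hq : Deg k q) (α β : ℝ) :
    Deg k (MvPolynomial.C α * p + MvPolynomial.C β * q) := by
  by_cases hk : k = 0
  · subst hk
    rcases hp with hp | hp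
    · rcases hq with hq | hq
      · left; simp [hp, hq]
      · omega
    · omega
  · have aux : ∀ (γ : ℝ) (r : Poly2), Deg k r → (MvPolynomial.C γ * r).totalDegree < k := by
      intro γ r hr
      rcases hr with hr | hr
      · subst hr
        simp
        omega
      · refine lt_of_le_of_lt (totalDegree_mul _ _) ?_
        simpa using hr
    right
    exact lt_of_le_of_lt (totalDegree_add _ _) (max_lt (aux α p hp) (aux β q hq))

/-- A polynomial with too many zeros on a line is divisible by the line. -/
theorem dvd_of_zeros {k : ℕ} {p : Poly2} (hp : Deg k p) {a b c : ℝ} (hab : a ≠ 0 ∨ b ≠ 0)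
    (T : Finset (ℝ × ℝ)) (hT : ∀ t ∈ T, a * t.1 + b * t.2 + c = 0) (hk : k ≤ T.card)
    (hz : ∀ t ∈ T, evalPt p t = 0) : ∃ q, p = lnPoly a b c * q ∧ Deg (k - 1) q := by
  classical
  by_cases hp0 : p = 0
  · exact ⟨0, by simp [hp0], Or.inl rfl⟩
  have hdeg : p.totalDegree < k := by
    rcases hp with h | h
    · exact absurd h hp0
    · exact h
  have hd : a ^ 2 + b ^ 2 ≠ 0 := by
    rcases hab with h | h
    · have := pow_pos (abs_pos.mpr h) 2
      rw [sq_abs] at this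
      have := sq_nonneg b
      linarith
    · have := pow_pos (abs_pos.mpr h) 2
      rw [sq_abs] at this
      have := sq_nonneg a
      linarith
  set d := a ^ 2 + b ^ 2 with hd_def
  let g : Fin 2 → Polynomial ℝ := fun i =>
    if i = 0 then Polynomial.C (-(a * c) / d) + Polynomial.C (-b) * Polynomial.X
    else Polynomial.C (-(b * c) / d) + Polynomial.C a * Polynomial.X
  let u : Polynomial ℝ := aeval g p
  let t : Poly2 := lnPoly (-b / d) (a / d) 0
  have hg : ∀ i, (g i).natDegree ≤ 1 := by
    intro i
    by_cases hi : i = 0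
    · simp only [g, hi, if_true]
      compute_degree
    · simp only [g, hi, if_false]
      compute_degree
  have hudeg : u.natDegree < k := by
    have := aeval_natDegree_le (m := p.totalDegree) (n := 1) p le_rfl g hg
    have h2 : u.natDegree ≤ p.totalDegree * 1 := this
    omega
  -- evaluation of u
  have hueval : ∀ s : ℝ, Polynomial.eval s u =
      evalPt p (-(a * c) / d - b * s, -(b * c) / d + a * s) := by
    intro s
    have : (Polynomial.evalRingHom s).comp (aeval g : Poly2 →ₐ[ℝ] Polynomial ℝ).toRingHom =
        MvPolynomial.eval (fun i : Fin 2 => if i = 0 then (-(a * c) / d - b * s)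
          else (-(b * c) / d + a * s)) := by
      apply MvPolynomial.ringHom_ext
      · intro r
        simp
      · intro i
        by_cases hi : i = 0
        · subst hi
          simp [g]
          ring
        · have : i = 1 := by omega
          subst this
          simp [g]
    have h2 := congrArg (fun φ => φ p) this
    simpa [evalPt, u] using h2
  have hu0 : u = 0 := by
    apply Polynomial.eq_zero_of_natDegree_lt_card_of_eval_eq_zero' u
      (T.image (fun q => (-b * q.1 + a * q.2) / d))
    · intro s hs
      obtain ⟨q, hq, rfl⟩ := Finset.mem_image.mp hs
      rw [hueval]
      have hq1 := hT q hq
      rw [← hz q hq]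
      congr 1
      ext
      · simp only
        field_simp
        rw [hd_def]
        linear_combination (-a) * hq1
      · simp only
        field_simp
        rw [hd_def]
        linear_combination (-b) * hq1
    · rw [Finset.card_image_of_injOn]
      · omega
      · intro q hq r hr hqr
        have h1 := hT q hq
        have h2 := hT r hr
        simp only at hqr
        have h3 : -b * q.1 + a * q.2 = -b * r.1 + a * r.2 := by
          field_simp at hqr
          linarith
        have e1 : d * (q.1 - r.1) = 0 := by
          rw [hd_def]
          linear_combination a * h1 - a * h2 - b * h3
        have e2 : d * (q.2 - r.2) = 0 := by
          rw [hd_def]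
          linear_combination b * h1 - b * h2 + a * h3
        ext
        · rcases mul_eq_zero.mp e1 with h | h
          · exact absurd h hd
          · linarith
        · rcases mul_eq_zero.mp e2 with h | h
          · exact absurd h hd
          · linarith
  -- divisibility
  have hdvd : lnPoly a b c ∣ p := by
    rw [← Ideal.mem_span_singleton, ← Ideal.Quotient.eq_zero_iff_mem]
    have key : (Ideal.Quotient.mkₐ ℝ (Ideal.span {lnPoly a b c})) =
        ((Ideal.Quotient.mkₐ ℝ (Ideal.span {lnPoly a b c})).comp
          ((Polynomial.aeval t).comp (aeval g))) := by
      apply MvPolynomial.algHom_ext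
      intro i
      simp only [AlgHom.comp_apply, aeval_X]
      rw [Ideal.Quotient.mkₐ_eq_mk, Ideal.Quotient.eq, Ideal.mem_span_singleton]
      have hdd : (MvPolynomial.C a ^ 2 + MvPolynomial.C b ^ 2 : Poly2) * MvPolynomial.C d⁻¹ = 1 := by
        rw [← C_pow, ← C_pow, ← C_add, ← C_mul, ← C_1, ← hd_def, mul_inv_cancel₀ hd]
      by_cases hi : i = 0
      · subst hi
        refine ⟨MvPolynomial.C (a * d⁻¹), ?_⟩
        simp only [g, t, lnPoly, if_true, map_add, map_mul, Polynomial.aeval_C, Polynomial.aeval_X,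
          MvPolynomial.algebraMap_eq, div_eq_mul_inv, C_neg, C_0]
        linear_combination (-(MvPolynomial.X 0 : Poly2)) * hdd
      · have : i = 1 := by omega
        subst this
        refine ⟨MvPolynomial.C (b * d⁻¹), ?_⟩
        simp only [g, t, lnPoly, map_add, map_mul, Polynomial.aeval_C, Polynomial.aeval_X,
          MvPolynomial.algebraMap_eq, div_eq_mul_inv, C_neg, C_0]
        simp only [one_ne_zero, if_false, map_add, map_mul, Polynomial.aeval_C, Polynomial.aeval_X,
          MvPolynomial.algebraMap_eq, div_eq_mul_inv, C_neg, C_0]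
        linear_combination (-(MvPolynomial.X 1 : Poly2)) * hdd
    have h2 := congrArg (fun φ => φ p) key
    simp only [AlgHom.comp_apply] at h2
    have h3 : (aeval g) p = 0 := hu0
    rw [h3] at h2
    simpa using h2
  obtain ⟨q, hq⟩ := hdvd
  refine ⟨q, hq, ?_⟩
  by_cases hq0 : q = 0
  · exact Or.inl hq0
  right
  have hl := totalDegree_lnPoly a b c hab
  have hl0 : lnPoly a b c ≠ 0 := by
    intro h
    rw [h] at hl
    simp at hl
  have := totalDegree_mul_of_isDomain hl0 hq0
  rw [← hq, hl] at this
  omega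


/-! ### Lines as sets -/

/-- `L` is a line, as a set of points. -/
def IsLn (L : Set (ℝ × ℝ)) : Prop :=
  ∃ a b c : ℝ, (a ≠ 0 ∨ b ≠ 0) ∧ ∀ p : ℝ × ℝ, p ∈ L ↔ a * p.1 + b * p.2 + c = 0

theorem line_sub {a b c a' b' c' : ℝ} (h : a ≠ 0 ∨ b ≠ 0) {p q r : ℝ × ℝ}
    (hpq : p ≠ q) (h1 : a * p.1 + b * p.2 + c = 0)
    (h2 : a * q.1 + b * q.2 + c = 0) (h1' : a' * p.1 + b' * p.2 + c' = 0)
    (h2' : a' * q.1 + b' * q.2 + c' = 0) (hr : a * r.1 + b * r.2 + c = 0) :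
    a' * r.1 + b' * r.2 + c' = 0 := by
  have e1 : a * (p.1 - q.1) + b * (p.2 - q.2) = 0 := by linear_combination h1 - h2
  have e2 : a' * (p.1 - q.1) + b' * (p.2 - q.2) = 0 := by linear_combination h1' - h2'
  have e3 : a * (r.1 - q.1) + b * (r.2 - q.2) = 0 := by linear_combination hr - h2
  have d : a * b' - a' * b = 0 := by
    by_contra hd
    apply hpq
    have x1 : (a * b' - a' * b) * (p.1 - q.1) = 0 := by linear_combination b' * e1 - b * e2
    have x2 : (a * b' - a' * b) * (p.2 - q.2) = 0 := by linear_combination a * e2 - a' * e1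
    have y1 := (mul_eq_zero.mp x1).resolve_left hd
    have y2 := (mul_eq_zero.mp x2).resolve_left hd
    ext <;> linarith
  rcases h with h | h
  · apply mul_left_cancel₀ h
    linear_combination a' * e3 + (r.2 - q.2) * d + a * h2'
  · apply mul_left_cancel₀ h
    linear_combination b' * e3 - (r.1 - q.1) * d + b * h2'

theorem IsLn.eq {L L' : Set (ℝ × ℝ)} (hL : IsLn L) (hL' : IsLn L') {p q : ℝ × ℝ} (hpq : p ≠ q)
    (hp : p ∈ L) (hq : q ∈ L) (hp' : p ∈ L') (hq' : q ∈ L') : L = L' := by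
  obtain ⟨a, b, c, h, hm⟩ := hL
  obtain ⟨a', b', c', h', hm'⟩ := hL'
  rw [hm] at hp hq
  rw [hm'] at hp' hq'
  ext r
  rw [hm, hm']
  exact ⟨line_sub h hpq hp hq hp' hq', line_sub h' hpq hp' hq' hp hq⟩

theorem IsLn.pt_eq {L L' : Set (ℝ × ℝ)} (hL : IsLn L) (hL' : IsLn L') (hne : L ≠ L') {p q : ℝ × ℝ}
    (hp : p ∈ L) (hq : q ∈ L) (hp' : p ∈ L') (hq' : q ∈ L') : p = q := by
  by_contra h
  exact hne (hL.eq hL' h hp hq hp' hq')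

theorem exists_line {p q : ℝ × ℝ} (hpq : p ≠ q) : ∃ L, IsLn L ∧ p ∈ L ∧ q ∈ L := by
  refine ⟨{r | (q.2 - p.2) * r.1 + (p.1 - q.1) * r.2 + (q.1 * p.2 - p.1 * q.2) = 0},
    ⟨_, _, _, ?_, fun r => Iff.rfl⟩, ?_, ?_⟩
  · by_contra hcon
    push Not at hcon
    apply hpq
    ext <;> linarith [hcon.1, hcon.2]
  · simp only [Set.mem_ofPred_eq]; ring
  · simp only [Set.mem_ofPred_eq]; ring

theorem mem_zeroSet {p : Poly2} {A : ℝ × ℝ} : A ∈ zeroSet p ↔ evalPt p A = 0 := Iff.rfl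

theorem isLn_zeroSet {p : Poly2} (hp : p.totalDegree = 1) : IsLn (zeroSet p) := by
  obtain ⟨a, b, c, rfl⟩ := eq_lnPoly_of_totalDegree p hp.le
  refine ⟨a, b, c, ?_, ?_⟩
  · by_contra hcon
    push Not at hcon
    rw [hcon.1, hcon.2] at hp
    simp [lnPoly] at hp
  · intro q
    simp only [zeroSet, Set.mem_ofPred_eq, evalPt_lnPoly]

theorem IsLn.exists_poly {L : Set (ℝ × ℝ)} (hL : IsLn L) :
    ∃ p : Poly2, p.totalDegree = 1 ∧ L = zeroSet p := by
  obtain ⟨a, b, c, h, hm⟩ := hL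
  refine ⟨lnPoly a b c, totalDegree_lnPoly a b c h, ?_⟩
  ext q
  simp only [zeroSet, Set.mem_ofPred_eq, evalPt_lnPoly, hm]

/-! ### Set version of the definitions -/

open Classical in
/-- nodes on `L` -/
noncomputable def onL (X : Finset (ℝ × ℝ)) (L : Set (ℝ × ℝ)) : Finset (ℝ × ℝ) := X.filter (· ∈ L)

open Classical in
/-- nodes off `L` -/
noncomputable def rem (X : Finset (ℝ × ℝ)) (L : Set (ℝ × ℝ)) : Finset (ℝ × ℝ) := X.filter (· ∉ L)

@[simp] theorem mem_onL {X : Finset (ℝ × ℝ)} {L : Set (ℝ × ℝ)} {A : ℝ × ℝ} :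
    A ∈ onL X L ↔ A ∈ X ∧ A ∈ L := by simp [onL]

@[simp] theorem mem_rem {X : Finset (ℝ × ℝ)} {L : Set (ℝ × ℝ)} {A : ℝ × ℝ} :
    A ∈ rem X L ↔ A ∈ X ∧ A ∉ L := by simp [rem]

theorem rem_comm (X : Finset (ℝ × ℝ)) (L M : Set (ℝ × ℝ)) :
    rem (rem X L) M = rem (rem X M) L := by
  ext A
  simp only [mem_rem]
  tauto

/-- maximal line -/
def Mx (n : ℕ) (X : Finset (ℝ × ℝ)) (L : Set (ℝ × ℝ)) : Prop := IsLn L ∧ (onL X L).card = n + 1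

/-- covering by lines -/
def Cov (n : ℕ) (X : Finset (ℝ × ℝ)) (A : ℝ × ℝ) (f : Fin n → Set (ℝ × ℝ)) : Prop :=
  (∀ i, IsLn (f i)) ∧ (∀ i, A ∉ f i) ∧ ∀ B ∈ X, B ≠ A → ∃ i, B ∈ f i

/-- GC sets, set version -/
def GC (n : ℕ) (X : Finset (ℝ × ℝ)) : Prop :=
  IsPoised n X ∧ ∀ A ∈ X, ∃ f : Fin n → Set (ℝ × ℝ), Cov n X A f

theorem gc_of_isGC {n : ℕ} {X : Finset (ℝ × ℝ)} (h : IsGC n X) : GC n X := by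
  refine ⟨h.1, fun A hA => ?_⟩
  obtain ⟨p, ⟨_, h1, h2⟩, f, hf, rfl⟩ := h.2 A hA
  refine ⟨fun i => zeroSet (f i), fun i => isLn_zeroSet (hf i), fun i hi => ?_, fun B hB hBA => ?_⟩
  · rw [evalPt_prod, Finset.prod_eq_zero (Finset.mem_univ i) (mem_zeroSet.mp hi)] at h1
    exact zero_ne_one h1
  · have := h2 B hB hBA
    rw [evalPt_prod, Finset.prod_eq_zero_iff] at this
    obtain ⟨i, _, hi⟩ := this
    exact ⟨i, hi⟩

theorem isGC_of_gc {n : ℕ} {X : Finset (ℝ × ℝ)} (h : GC n X) : IsGC n X := by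
  refine ⟨h.1, fun A hA => ?_⟩
  obtain ⟨f, hf1, hf2, hf3⟩ := h.2 A hA
  choose g hg1 hg2 using fun i => (hf1 i).exists_poly
  have gA : ∀ i, evalPt (g i) A ≠ 0 := by
    intro i hi
    apply hf2 i
    rw [hg2 i]
    exact hi
  suffices ∃ g' : Fin n → Poly2, (∀ i, (g' i).totalDegree = 1) ∧ (∏ i, evalPt (g' i) A = 1) ∧
      ∀ i B, evalPt (g i) B = 0 → evalPt (g' i) B = 0 by
    obtain ⟨g', h1, h2, h3⟩ := this
    refine ⟨∏ i, g' i, ⟨?_, ?_, ?_⟩, g', h1, rfl⟩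
    · refine (totalDegree_finsetProd _ _).trans ?_
      simp [h1]
    · rw [evalPt_prod, h2]
    · intro B hB hBA
      obtain ⟨i, hi⟩ := hf3 B hB hBA
      rw [evalPt_prod]
      apply Finset.prod_eq_zero (Finset.mem_univ i)
      apply h3
      rw [hg2 i] at hi
      exact hi
  refine ⟨fun i => MvPolynomial.C (evalPt (g i) A)⁻¹ * g i, ?_, ?_, ?_⟩
  · intro i
    have h0 : g i ≠ 0 := by
      intro h0
      have := hg1 i
      rw [h0] at this
      simp at this
    have h1 : (MvPolynomial.C (evalPt (g i) A)⁻¹ : Poly2) ≠ 0 := by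
      simpa using gA i
    rw [totalDegree_mul_of_isDomain h1 h0, hg1]
    simp
  · apply Finset.prod_eq_one
    intro i _
    rw [evalPt_mul, evalPt_C, inv_mul_cancel₀ (gA i)]
  · intro i B hB
    rw [evalPt_mul, hB, mul_zero]

theorem onL_zeroSet (X : Finset (ℝ × ℝ)) (p : Poly2) : onL X (zeroSet p) = nodesOn X p := by
  ext A
  simp [nodesOn, mem_zeroSet]

theorem mx_iff {n : ℕ} {X : Finset (ℝ × ℝ)} {p : Poly2} (h : IsMaximalLine n X p) :
    Mx n X (zeroSet p) := by
  refine ⟨isLn_zeroSet h.1, ?_⟩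
  rw [onL_zeroSet]
  exact h.2

theorem Mx.exists {n : ℕ} {X : Finset (ℝ × ℝ)} {L : Set (ℝ × ℝ)} (h : Mx n X L) :
    ∃ p, IsMaximalLine n X p ∧ L = zeroSet p := by
  obtain ⟨p, hp, rfl⟩ := h.1.exists_poly
  refine ⟨p, ⟨hp, ?_⟩, rfl⟩
  rw [← onL_zeroSet]
  exact h.2

/-! ### Covering lemmas -/

theorem cover_card_le {n : ℕ} {L : Set (ℝ × ℝ)} (hL : IsLn L) {f : Fin n → Set (ℝ × ℝ)}
    (hf : ∀ i, IsLn (f i)) (hne : ∀ i, f i ≠ L) {T : Finset (ℝ × ℝ)} (hT : ∀ t ∈ T, t ∈ L)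
    (hc : ∀ t ∈ T, ∃ i, t ∈ f i) : T.card ≤ n := by
  classical
  rcases T.eq_empty_or_nonempty with he | ⟨t0, ht0⟩
  · simp [he]
  haveI : Nonempty (Fin n) := ⟨(hc t0 ht0).choose⟩
  choose! φ hφ using hc
  by_contra hlt
  have hlt : (Finset.univ : Finset (Fin n)).card < T.card := by simpa using hlt
  obtain ⟨x, hx, y, hy, hxy, he⟩ := Finset.exists_ne_map_eq_of_card_lt_of_maps_to hlt
    (f := φ) (by intro x hx; simp)
  exact hne (φ x) ((hf _).eq hL hxy (hφ x hx) (he ▸ hφ y hy) (hT x hx) (hT y hy))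

theorem cover_bij {n : ℕ} {L : Set (ℝ × ℝ)} (hL : IsLn L) {f : Fin n → Set (ℝ × ℝ)}
    (hf : ∀ i, IsLn (f i)) (hne : ∀ i, f i ≠ L) {T : Finset (ℝ × ℝ)} (hT : ∀ t ∈ T, t ∈ L)
    (hc : ∀ t ∈ T, ∃ i, t ∈ f i) (hn : n ≤ T.card) :
    (∀ i, ∃ t ∈ T, t ∈ f i) ∧ ∀ t ∈ T, ∀ i j, t ∈ f i → t ∈ f j → i = j := by
  classical
  rcases T.eq_empty_or_nonempty with he | ⟨t0, ht0⟩
  · have : n = 0 := by simpa [he] using hn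
    subst this
    exact ⟨fun i => i.elim0, fun _ _ i => i.elim0⟩
  haveI : Nonempty (Fin n) := ⟨(hc t0 ht0).choose⟩
  choose! φ hφ using hc
  have inj : Set.InjOn φ T := by
    intro x hx y hy he
    exact (hf _).pt_eq hL (hne (φ x)) (hφ x hx) (he ▸ hφ y hy) (hT x hx) (hT y hy)
  have surj : ∀ i, ∃ t ∈ T, φ t = i := by
    intro i
    have h1 : T.image φ = Finset.univ := by
      apply Finset.eq_univ_of_card
      rw [Finset.card_image_of_injOn inj]
      apply le_antisymm
      · rw [← Finset.card_image_of_injOn inj]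
        exact Finset.card_le_univ _
      · simpa using hn
    have : i ∈ T.image φ := by rw [h1]; simp
    simpa using this
  have key : ∀ t ∈ T, ∀ i, t ∈ f i → φ t = i := by
    intro t ht i hti
    obtain ⟨s, hs, rfl⟩ := surj i
    have : t = s := (hf _).pt_eq hL (hne (φ s)) hti (hφ s hs) (hT t ht) (hT s hs)
    rw [this]
  refine ⟨fun i => ?_, fun t ht i j hi hj => (key t ht i hi).symm.trans (key t ht j hj)⟩
  obtain ⟨t, ht, rfl⟩ := surj i
  exact ⟨t, ht, hφ t ht⟩

/-- A node off a maximal line uses it. -/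
theorem Mx.used {n : ℕ} {X : Finset (ℝ × ℝ)} {M : Set (ℝ × ℝ)} (hM : Mx n X M)
    {A : ℝ × ℝ} (hA : A ∉ M) {f : Fin n → Set (ℝ × ℝ)} (hf : Cov n X A f) : ∃ i, f i = M := by
  by_contra hcon
  push Not at hcon
  have := cover_card_le hM.1 hf.1 hcon (T := onL X M) (by simp) (by
    intro t ht
    rw [mem_onL] at ht
    exact hf.2.2 t ht.1 (by rintro rfl; exact hA ht.2))
  rw [hM.2] at this
  omega

theorem card_rem (X : Finset (ℝ × ℝ)) (L : Set (ℝ × ℝ)) :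
    (onL X L).card + (rem X L).card = X.card := by
  classical
  exact Finset.card_filter_add_card_filter_not (s := X) (· ∈ L)

theorem GC.rem {n : ℕ} {X : Finset (ℝ × ℝ)} {M : Set (ℝ × ℝ)} (h : GC (n + 1) X)
    (hM : Mx (n + 1) X M) : GC n (rem X M) := by
  refine ⟨⟨?_, ?_⟩, ?_⟩
  · have h1 := card_rem X M
    have h2 := h.1.1
    have h3 := hM.2
    have h4 : (n + 1 + 2).choose 2 = (n + 2) + (n + 2).choose 2 := by
      rw [show n + 1 + 2 = (n + 2) + 1 from rfl, Nat.choose_succ_succ' (n + 2) 1]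
      simp
    omega
  · intro p hp hz
    obtain ⟨ℓ, hℓ, hMℓ⟩ := hM.1.exists_poly
    have hl0 : ℓ ≠ 0 := by
      rintro rfl
      simp at hℓ
    have : ℓ * p = 0 := by
      apply h.1.2
      · refine (totalDegree_mul _ _).trans ?_
        omega
      · intro A hA
        rw [evalPt_mul]
        by_cases hAM : A ∈ M
        · rw [hMℓ] at hAM
          have : evalPt ℓ A = 0 := hAM
          rw [this, zero_mul]
        · rw [hz A (by simp [hA, hAM]), mul_zero]
    exact (mul_eq_zero.mp this).resolve_left hl0
  · intro A hA
    rw [mem_rem] at hA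
    obtain ⟨f, hf⟩ := h.2 A hA.1
    obtain ⟨i, hi⟩ := hM.used hA.2 hf
    refine ⟨fun j => f (i.succAbove j), fun j => hf.1 _, fun j => hf.2.1 _, ?_⟩
    intro B hB hBA
    rw [mem_rem] at hB
    obtain ⟨k, hk⟩ := hf.2.2 B hB.1 hBA
    have hki : k ≠ i := by
      rintro rfl
      rw [hi] at hk
      exact hB.2 hk
    obtain ⟨j, rfl⟩ := Fin.exists_succAbove_eq hki
    exact ⟨j, hk⟩

theorem GC.card_le {n : ℕ} {X : Finset (ℝ × ℝ)} {L : Set (ℝ × ℝ)} (h : GC n X) (hL : IsLn L) :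
    (onL X L).card ≤ n + 1 := by
  classical
  by_cases he : (onL X L) = ∅
  · simp [he]
  obtain ⟨A, hA⟩ := Finset.nonempty_iff_ne_empty.mpr he
  have hA' := mem_onL.mp hA
  obtain ⟨f, hf⟩ := h.2 A hA'.1
  have := cover_card_le hL hf.1 (by rintro i rfl; exact hf.2.1 i hA'.2) (T := (onL X L).erase A)
    (by intro t ht; simp at ht; exact ht.2.2) (by
      intro t ht
      simp at ht
      exact hf.2.2 t ht.2.1 ht.1)
  rw [Finset.card_erase_of_mem hA] at this
  omega

theorem GC.card_zero {X : Finset (ℝ × ℝ)} (h : GC 0 X) : ∃ A, X = {A} := by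
  rw [← Finset.card_eq_one, h.1.1]
  rfl

theorem GC.zero_unique {X : Finset (ℝ × ℝ)} (h : GC 0 X) {A B : ℝ × ℝ} (hA : A ∈ X) (hB : B ∈ X) :
    A = B := by
  obtain ⟨C, rfl⟩ := h.card_zero
  simp at hA hB
  rw [hA, hB]

theorem Mx.nonempty {n : ℕ} {X : Finset (ℝ × ℝ)} {L : Set (ℝ × ℝ)} (h : Mx n X L) :
    ∃ A ∈ X, A ∈ L := by
  have : (onL X L).Nonempty := by
    rw [← Finset.card_pos, h.2]
    omega
  obtain ⟨A, hA⟩ := this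
  exact ⟨A, (mem_onL.mp hA).1, (mem_onL.mp hA).2⟩

theorem card_split (X : Finset (ℝ × ℝ)) (L M : Set (ℝ × ℝ)) :
    (onL X L).card = (onL (onL X L) M).card + (onL (rem X M) L).card := by
  rw [← card_rem (onL X L) M]
  congr 2
  ext A
  simp only [mem_onL, mem_rem]
  tauto

/-- Two maximal lines meet at a node. -/
theorem GC.node {n : ℕ} {X : Finset (ℝ × ℝ)} {L M : Set (ℝ × ℝ)} (h : GC n X)
    (hM : Mx n X M) (hL : Mx n X L) : ∃ A ∈ X, A ∈ M ∧ A ∈ L := by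
  cases n with
  | zero =>
    obtain ⟨A, hA, hAM⟩ := hM.nonempty
    obtain ⟨B, hB, hBL⟩ := hL.nonempty
    refine ⟨A, hA, hAM, ?_⟩
    rw [h.zero_unique hA hB]
    exact hBL
  | succ n =>
    have h1 := (h.rem hM).card_le hL.1
    have h2 := card_split X L M
    have h3 := hL.2
    have : (onL (onL X L) M).Nonempty := by
      rw [← Finset.card_pos]
      omega
    obtain ⟨A, hA⟩ := this
    simp only [mem_onL] at hA
    exact ⟨A, hA.1.1, hA.2, hA.1.2⟩

theorem card_common_le {X : Finset (ℝ × ℝ)} {L M : Set (ℝ × ℝ)} (hL : IsLn L) (hM : IsLn M)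
    (hne : L ≠ M) : (onL (onL X L) M).card ≤ 1 := by
  rw [Finset.card_le_one]
  intro a ha b hb
  simp only [mem_onL] at ha hb
  exact hL.pt_eq hM hne ha.1.2 hb.1.2 ha.2 hb.2

theorem GC.down {n : ℕ} {X : Finset (ℝ × ℝ)} {L M : Set (ℝ × ℝ)} (h : GC (n + 1) X)
    (hM : Mx (n + 1) X M) (hL : Mx (n + 1) X L) (hne : L ≠ M) : Mx n (_root_.rem X M) L := by
  refine ⟨hL.1, ?_⟩
  have h1 := (h.rem hM).card_le hL.1
  have h2 := card_split X L M
  have h3 := card_common_le (X := X) hL.1 hM.1 hne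
  have h4 := hL.2
  omega

theorem Mx.ne_rem {n : ℕ} {X : Finset (ℝ × ℝ)} {L M : Set (ℝ × ℝ)} (h : Mx n (rem X M) L) :
    L ≠ M := by
  rintro rfl
  obtain ⟨A, hA, hAL⟩ := h.nonempty
  exact (mem_rem.mp hA).2 hAL

theorem Mx.up {n : ℕ} {X : Finset (ℝ × ℝ)} {L M : Set (ℝ × ℝ)} (h : Mx n (rem X M) L)
    (hM : IsLn M) {A : ℝ × ℝ} (hA : A ∈ X) (hAL : A ∈ L) (hAM : A ∈ M) : Mx (n + 1) X L := by
  refine ⟨h.1, ?_⟩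
  have h2 := card_split X L M
  have h3 := card_common_le (X := X) h.1 hM h.ne_rem
  have h4 := h.2
  have : 0 < (onL (onL X L) M).card := by
    rw [Finset.card_pos]
    exact ⟨A, by simp [hA, hAL, hAM]⟩
  omega


/-! ### At most one bad line -/

theorem prod_poly {n : ℕ} (g : Fin n → Set (ℝ × ℝ)) (hg : ∀ i, IsLn (g i)) :
    ∃ p : Poly2, Deg (n + 1) p ∧ ∀ P, evalPt p P = 0 ↔ ∃ k, P ∈ g k := by
  choose q hq1 hq2 using fun i => (hg i).exists_poly
  refine ⟨∏ i, q i, Or.inr ?_, fun P => ?_⟩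
  · refine Nat.lt_succ_of_le ((totalDegree_finsetProd _ _).trans ?_)
    simp [hq1]
  · rw [evalPt_prod, Finset.prod_eq_zero_iff]
    constructor
    · rintro ⟨i, _, hi⟩
      exact ⟨i, by rw [hq2 i]; exact hi⟩
    · rintro ⟨i, hi⟩
      rw [hq2 i] at hi
      exact ⟨i, Finset.mem_univ i, hi⟩

/-- `M` and `K` do not meet at a node. -/
def NoMeet (X : Finset (ℝ × ℝ)) (M K : Set (ℝ × ℝ)) : Prop := ∀ A ∈ X, A ∈ M → A ∉ K

theorem Mx.hit {n : ℕ} {X : Finset (ℝ × ℝ)} {M : Set (ℝ × ℝ)}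
    (hM : Mx n X M) {A : ℝ × ℝ} (hA : A ∈ X) (hAM : A ∈ M)
    {f : Fin n → Set (ℝ × ℝ)} (hf : Cov n X A f) :
    (∀ i, ∃ t ∈ X, t ∈ M ∧ t ≠ A ∧ t ∈ f i) ∧
      ∀ t ∈ X, t ∈ M → t ≠ A → ∀ i j, t ∈ f i → t ∈ f j → i = j := by
  classical
  have hmem : A ∈ onL X M := by simp [hA, hAM]
  have h := cover_bij hM.1 hf.1 (by rintro i rfl; exact hf.2.1 i hAM) (T := (onL X M).erase A)
    (by intro t ht; simp at ht; exact ht.2.2) (by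
      intro t ht
      simp at ht
      exact hf.2.2 t ht.2.1 ht.1) (by rw [Finset.card_erase_of_mem hmem, hM.2]; simp)
  refine ⟨fun i => ?_, fun t ht htM htA i j hi hj => h.2 t (by simp [ht, htM, htA]) i j hi hj⟩
  obtain ⟨t, ht, hti⟩ := h.1 i
  simp at ht
  exact ⟨t, ht.2.1, ht.2.2, ht.1, hti⟩

theorem lines_inj {n : ℕ} {X : Finset (ℝ × ℝ)} {M M1 M2 : Set (ℝ × ℝ)}
    (hM : Mx (n + 1) X M) (hM1 : Mx n (rem X M) M1) (hM2 : Mx n (rem X M) M2) (h12 : M1 ≠ M2)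
    (no1 : NoMeet X M M1) (no2 : NoMeet X M M2)
    {C : ℝ × ℝ} (hC : C ∈ rem X M) (hC1 : C ∈ M1) (hC2 : C ∈ M2)
    {A B : ℝ × ℝ} (hA : A ∈ X) (hAM : A ∈ M) (hB : B ∈ X) (hBM : B ∈ M) (hAB : A ≠ B)
    {f g : Fin (n + 1) → Set (ℝ × ℝ)} (hf : Cov (n + 1) X A f) (hg : Cov (n + 1) X B g)
    {i j : Fin (n + 1)} (hCf : C ∈ f i) (hfg : f i = g j) : False := by
  classical
  obtain ⟨D, hDX, hDM, hDA, hDf⟩ := (hM.hit hA hAM hf).1 i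
  have hDB : D ≠ B := by
    rintro rfl
    rw [hfg] at hDf
    exact hg.2.1 j hDf
  have hCM : C ∉ M := (mem_rem.mp hC).2
  have hCX : C ∈ X := (mem_rem.mp hC).1
  have f1 : f i ≠ M1 := by
    intro h
    rw [h] at hDf
    exact no1 D hDX hDM hDf
  have f2 : f i ≠ M2 := by
    intro h
    rw [h] at hDf
    exact no2 D hDX hDM hDf
  have fM : f i ≠ M := by
    intro h
    rw [h] at hCf
    exact hCM hCf
  have hAf : A ∉ f i := hf.2.1 i
  have hBf : B ∉ f i := by rw [hfg]; exact hg.2.1 j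
  obtain ⟨a, ha, haz⟩ := prod_poly (fun k => f (i.succAbove k)) (fun k => hf.1 _)
  obtain ⟨b, hb, hbz⟩ := prod_poly (fun k => g (j.succAbove k)) (fun k => hg.1 _)
  have za : ∀ P ∈ X, P ≠ A → P ∉ f i → evalPt a P = 0 := by
    intro P hP hPA hPf
    rw [haz]
    obtain ⟨k, hk⟩ := hf.2.2 P hP hPA
    have hki : k ≠ i := by
      rintro rfl
      exact hPf hk
    obtain ⟨l, rfl⟩ := Fin.exists_succAbove_eq hki
    exact ⟨l, hk⟩
  have zb : ∀ P ∈ X, P ≠ B → P ∉ f i → evalPt b P = 0 := by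
    intro P hP hPA hPf
    rw [hbz]
    obtain ⟨k, hk⟩ := hg.2.2 P hP hPA
    have hki : k ≠ j := by
      rintro rfl
      rw [hfg] at hPf
      exact hPf hk
    obtain ⟨l, rfl⟩ := Fin.exists_succAbove_eq hki
    exact ⟨l, hk⟩
  have aA : evalPt a A ≠ 0 := by
    rw [Ne, haz]
    rintro ⟨k, hk⟩
    exact hf.2.1 _ hk
  have bB : evalPt b B ≠ 0 := by
    rw [Ne, hbz]
    rintro ⟨k, hk⟩
    exact hg.2.1 _ hk
  have bA : evalPt b A = 0 := zb A hA hAB hAf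
  have aB : evalPt a B = 0 := za B hB hAB.symm hBf
  obtain ⟨α, β, hαβ, hw⟩ : ∃ α β : ℝ, (α ≠ 0 ∨ β ≠ 0) ∧
      α * evalPt a C + β * evalPt b C = 0 := by
    by_cases h : evalPt b C = 0
    · by_cases h' : evalPt a C = 0
      · exact ⟨1, 0, by simp, by simp [h']⟩
      · exact ⟨evalPt b C, -evalPt a C, by simp [h'], by ring⟩
    · exact ⟨evalPt b C, -evalPt a C, by simp [h], by ring⟩
  set w := MvPolynomial.C α * a + MvPolynomial.C β * b with hwdef
  have we : ∀ P, evalPt w P = α * evalPt a P + β * evalPt b P := by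
    intro P
    rw [hwdef, evalPt_add, evalPt_mul, evalPt_mul, evalPt_C, evalPt_C]
  have wz : ∀ P ∈ X, P ≠ A → P ≠ B → P ∉ f i → evalPt w P = 0 := by
    intro P hP hPA hPB hPf
    rw [we, za P hP hPA hPf, zb P hP hPB hPf]
    ring
  have hwdeg : Deg (n + 1) w := ha.combo hb α β
  obtain ⟨a1, b1, c1, ab1, m1⟩ := hM1.1
  obtain ⟨a2, b2, c2, ab2, m2⟩ := hM2.1
  obtain ⟨a3, b3, c3, ab3, m3⟩ := hM.1
  obtain ⟨s, hs, hsd⟩ := dvd_of_zeros hwdeg ab1 (onL (rem X M) M1)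
    (by
      intro t ht
      rw [← m1]
      exact (mem_onL.mp ht).2) hM1.2.ge (by
      intro t ht
      simp only [mem_onL, mem_rem] at ht
      by_cases htC : t = C
      · rw [htC, we, hw]
      · apply wz t ht.1.1
        · rintro rfl; exact ht.1.2 hAM
        · rintro rfl; exact ht.1.2 hBM
        · intro htf
          exact htC ((hf.1 i).pt_eq hM1.1 f1 htf hCf ht.2 hC1))
  obtain ⟨r, hr, hrd⟩ := dvd_of_zeros hsd ab2 ((onL (rem X M) M2).erase C)
    (by
      intro t ht
      simp at ht
      rw [← m2]
      exact ht.2.2) (by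
      rw [Finset.card_erase_of_mem (by simp at hC; simp [hC, hC2]), hM2.2]) (by
      intro t ht
      simp at ht
      have h1 : evalPt w t = 0 := by
        apply wz t ht.2.1.1
        · rintro rfl; exact ht.2.1.2 hAM
        · rintro rfl; exact ht.2.1.2 hBM
        · intro htf
          exact ht.1 ((hf.1 i).pt_eq hM2.1 f2 htf hCf ht.2.2 hC2)
      rw [hs, evalPt_mul, evalPt_lnPoly] at h1
      refine (mul_eq_zero.mp h1).resolve_left ?_
      rw [← m1]
      intro h
      exact ht.1 (hM1.1.pt_eq hM2.1 h12 h hC1 ht.2.2 hC2))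
  have hoff : ∀ t ∈ X, t ∈ M → (evalPt w t = 0 ↔ evalPt r t = 0) := by
    intro t ht htM
    rw [hs, hr, evalPt_mul, evalPt_mul, evalPt_lnPoly, evalPt_lnPoly]
    have e1 := no1 t ht htM
    have e2 := no2 t ht htM
    rw [m1] at e1
    rw [m2] at e2
    simp [e1, e2]
  obtain ⟨u, hu, _⟩ := dvd_of_zeros hrd ab3 ((((onL X M).erase A).erase B).erase D)
    (by
      intro t ht
      simp at ht
      rw [← m3]
      exact ht.2.2.2.2) (by
      rw [Finset.card_erase_of_mem (by simp [hDB, hDA, hDX, hDM]),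
        Finset.card_erase_of_mem (by simp [hAB.symm, hB, hBM]),
        Finset.card_erase_of_mem (by simp [hA, hAM]), hM.2]
      omega) (by
      intro t ht
      simp at ht
      rw [← hoff t ht.2.2.2.1 ht.2.2.2.2]
      apply wz t ht.2.2.2.1 ht.2.2.1 ht.2.1
      intro htf
      exact ht.1 ((hf.1 i).pt_eq hM.1 fM htf hDf ht.2.2.2.2 hDM))
  have rz : ∀ t ∈ M, evalPt r t = 0 := by
    intro t ht
    rw [hu, evalPt_mul, evalPt_lnPoly, (m3 t).mp ht, zero_mul]
  have wA := (hoff A hA hAM).mpr (rz A hAM)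
  have wB := (hoff B hB hBM).mpr (rz B hBM)
  rw [we, bA] at wA
  rw [we, aB] at wB
  rcases hαβ with h | h
  · apply h
    simpa [aA] using wA
  · apply h
    simpa [bB] using wB

theorem GC.not_concurrent {n : ℕ} {X : Finset (ℝ × ℝ)} {L M N : Set (ℝ × ℝ)} (h : GC (n + 1) X)
    (hL : Mx (n + 1) X L) (hM : Mx (n + 1) X M) (hN : Mx (n + 1) X N) (h1 : L ≠ M) (h2 : L ≠ N)
    (h3 : M ≠ N) {A : ℝ × ℝ} (hAL : A ∈ L) (hAM : A ∈ M) : A ∉ N := by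
  obtain ⟨B, hB, hBL, hBM⟩ := (h.rem hN).node (h.down hN hL h2) (h.down hN hM h3)
  rw [hL.1.pt_eq hM.1 h1 hAL hBL hAM hBM]
  exact (mem_rem.mp hB).2

theorem bad_core {n : ℕ} {X : Finset (ℝ × ℝ)} {M M1 M2 M3 : Set (ℝ × ℝ)} (h : GC (n + 2) X)
    (hM : Mx (n + 2) X M) (hM1 : Mx (n + 1) (rem X M) M1) (hM2 : Mx (n + 1) (rem X M) M2)
    (hM3 : Mx (n + 1) (rem X M) M3) (h12 : M1 ≠ M2) (h13 : M1 ≠ M3) (h23 : M2 ≠ M3)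
    (no1 : NoMeet X M M1) (no2 : NoMeet X M M2) : False := by
  classical
  obtain ⟨C, hC, hC1, hC2⟩ := (h.rem hM).node hM1 hM2
  have hC3 : C ∉ M3 := (h.rem hM).not_concurrent hM1 hM2 hM3 h12 h13 h23 hC1 hC2
  have hCX := (mem_rem.mp hC).1
  have hCM := (mem_rem.mp hC).2
  have key : ∀ A, ∃ (f : Fin (n + 2) → Set (ℝ × ℝ)) (i : Fin (n + 2)), A ∈ onL X M →
      Cov (n + 2) X A f ∧ C ∈ f i := by
    intro A
    by_cases hA : A ∈ onL X M
    · obtain ⟨f, hf⟩ := h.2 A (mem_onL.mp hA).1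
      obtain ⟨i, hi⟩ := hf.2.2 C hCX (by rintro rfl; exact hCM (mem_onL.mp hA).2)
      exact ⟨f, i, fun _ => ⟨hf, hi⟩⟩
    · exact ⟨fun _ => ∅, 0, fun h => absurd h hA⟩
  choose f i hfi using key
  have inj : ∀ A ∈ onL X M, ∀ B ∈ onL X M, f A (i A) = f B (i B) → A = B := by
    intro A hA B hB he
    by_contra hAB
    have hA' := mem_onL.mp hA
    have hB' := mem_onL.mp hB
    exact lines_inj hM hM1 hM2 h12 no1 no2 hC hC1 hC2 hA'.1 hA'.2 hB'.1 hB'.2 hAB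
      (hfi A hA).1 (hfi B hB).1 (hfi A hA).2 he
  have inj2 : ∀ A ∈ onL X M, ∀ B ∈ onL X M, ∀ P, P ≠ C → P ∈ f A (i A) → P ∈ f B (i B) →
      A = B := by
    intro A hA B hB P hPC h1 h2
    exact inj A hA B hB (((hfi A hA).1.1 _).eq ((hfi B hB).1.1 _) hPC h1 (hfi A hA).2
      h2 (hfi B hB).2)
  have hit : ∀ A, ∃ D, A ∈ onL X M → D ∈ onL X M ∧ D ≠ A ∧ D ∈ f A (i A) := by
    intro A
    by_cases hA : A ∈ onL X M
    · have hA' := mem_onL.mp hA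
      obtain ⟨D, h1, h2, h3, h4⟩ := (hM.hit hA'.1 hA'.2 (hfi A hA).1).1 (i A)
      exact ⟨D, fun _ => ⟨by simp [h1, h2], h3, h4⟩⟩
    · exact ⟨0, fun h => absurd h hA⟩
  choose D hD using hit
  by_cases hE : ∃ E ∈ X, E ∈ M ∧ E ∈ M3
  · obtain ⟨E, hEX, hEM, hE3⟩ := hE
    have hM3X : Mx (n + 2) X M3 := hM3.up hM.1 hEX hE3 hEM
    have surj := Finset.surj_on_of_inj_on_of_card_le (s := onL X M) (t := onL X M)
      (fun A _ => D A) (fun A hA => (hD A hA).1) (by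
        intro A B hA hB he
        refine inj2 A hA B hB (D A) ?_ (hD A hA).2.2 (he ▸ (hD B hB).2.2)
        intro hDC
        exact hCM (hDC ▸ (mem_onL.mp (hD A hA).1).2)) le_rfl
    obtain ⟨A, hA, hEA⟩ := surj E (by simp [hEX, hEM])
    have hA' := mem_onL.mp hA
    have hEne : E ≠ A := hEA ▸ (hD A hA).2.1
    have hA3 : A ∉ M3 := by
      intro hA3
      exact hEne (hM.1.pt_eq hM3.1 hM3.ne_rem.symm hEM hA'.2 hE3 hA3)
    obtain ⟨j, hj⟩ := hM3X.used hA3 (hfi A hA).1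
    have hij := (hM.hit hA'.1 hA'.2 (hfi A hA).1).2 E hEX hEM hEne (i A) j
      (hEA ▸ (hD A hA).2.2) (by rw [hj]; exact hE3)
    have := (hfi A hA).2
    rw [hij, hj] at this
    exact hC3 this
  · have hH : ∀ A ∈ onL X M, ∃ H, H ∈ onL (rem X M) M3 ∧ H ∈ f A (i A) := by
      intro A hA
      have hA' := mem_onL.mp hA
      have hc := cover_bij hM3.1 (hfi A hA).1.1 (by
          intro k hk
          obtain ⟨t, h1, h2, _, h4⟩ := (hM.hit hA'.1 hA'.2 (hfi A hA).1).1 k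
          rw [hk] at h4
          exact hE ⟨t, h1, h2, h4⟩) (T := onL (rem X M) M3) (by simp) (by
          intro t ht
          simp at ht
          exact (hfi A hA).1.2.2 t ht.1.1 (by rintro rfl; exact ht.1.2 hA'.2)) hM3.2.ge
      exact hc.1 (i A)
    choose! H hH1 hH2 using hH
    have hlt : (onL (rem X M) M3).card < (onL X M).card := by
      rw [hM3.2, hM.2]
      omega
    obtain ⟨A, hA, B, hB, hAB, he⟩ := Finset.exists_ne_map_eq_of_card_lt_of_maps_to hlt (f := H)
      (by intro A hA; exact hH1 A hA)
    apply hAB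
    refine inj2 A hA B hB (H A) ?_ (hH2 A hA) (he ▸ hH2 B hB)
    intro hHC
    have := hH1 A hA
    rw [hHC] at this
    exact hC3 (mem_onL.mp this).2

/-! ### Sets with the GM property -/

/-- GC set together with the GM conjecture up to its degree. -/
def GCM (n : ℕ) (X : Finset (ℝ × ℝ)) : Prop := GC n X ∧ ∀ m ≤ n, GM m

theorem GCM.rem {n : ℕ} {X : Finset (ℝ × ℝ)} {M : Set (ℝ × ℝ)} (h : GCM (n + 1) X)
    (hM : Mx (n + 1) X M) : GCM n (rem X M) :=
  ⟨h.1.rem hM, fun m hm => h.2 m (by omega)⟩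

theorem GCM.exists_mx {n : ℕ} {X : Finset (ℝ × ℝ)} (h : GCM n X) : ∃ M, Mx n X M := by
  obtain ⟨p, hp⟩ := h.2 n le_rfl X (isGC_of_gc h.1)
  exact ⟨_, mx_iff hp⟩

/-- In a `GC_1` set, the line through two nodes is maximal. -/
theorem GC.line_one {X : Finset (ℝ × ℝ)} (h : GC 1 X) {L : Set (ℝ × ℝ)} (hL : IsLn L)
    {u v : ℝ × ℝ} (hu : u ∈ X) (hv : v ∈ X) (huv : u ≠ v) (huL : u ∈ L) (hvL : v ∈ L) :
    Mx 1 X L := by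
  refine ⟨hL, le_antisymm (h.card_le hL) ?_⟩
  have : 1 < (onL X L).card := by
    rw [Finset.one_lt_card]
    exact ⟨u, by simp [hu, huL], v, by simp [hv, hvL], huv⟩
  omega

theorem GCM.three {n : ℕ} : ∀ {X : Finset (ℝ × ℝ)}, GCM (n + 1) X →
    ∃ L1 L2 L3, Mx (n + 1) X L1 ∧ Mx (n + 1) X L2 ∧ Mx (n + 1) X L3 ∧
      L1 ≠ L2 ∧ L1 ≠ L3 ∧ L2 ≠ L3 := by
  induction n with
  | zero =>
    intro X h
    obtain ⟨M, hM⟩ := h.exists_mx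
    have : 1 < (onL X M).card := by rw [hM.2]; omega
    obtain ⟨u, hu, v, hv, huv⟩ := Finset.one_lt_card.mp this
    rw [mem_onL] at hu hv
    obtain ⟨w, hw⟩ := (h.1.rem hM).card_zero
    have hwr : w ∈ _root_.rem X M := by rw [hw]; simp
    rw [mem_rem] at hwr
    have hwu : w ≠ u := by rintro rfl; exact hwr.2 hu.2
    have hwv : w ≠ v := by rintro rfl; exact hwr.2 hv.2
    obtain ⟨L1, hL1, a1, b1⟩ := exists_line hwu
    obtain ⟨L2, hL2, a2, b2⟩ := exists_line hwv
    refine ⟨M, L1, L2, hM, h.1.line_one hL1 hwr.1 hu.1 hwu a1 b1,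
      h.1.line_one hL2 hwr.1 hv.1 hwv a2 b2, ?_, ?_, ?_⟩
    · rintro rfl; exact hwr.2 a1
    · rintro rfl; exact hwr.2 a2
    · rintro rfl
      apply hwr.2
      rw [hM.1.eq hL1 huv hu.2 hv.2 b1 b2]
      exact a1
  | succ n ih =>
    intro X h
    obtain ⟨M, hM⟩ := h.exists_mx
    obtain ⟨L1, L2, L3, h1, h2, h3, h12, h13, h23⟩ := ih (h.rem hM)
    have good : ∀ L, Mx (n + 1) (_root_.rem X M) L → ¬ NoMeet X M L → Mx (n + 2) X L := by
      intro L hL hno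
      unfold NoMeet at hno
      push Not at hno
      obtain ⟨A, hA, hAM, hAL⟩ := hno
      exact hL.up hM.1 hA hAL hAM
    by_cases n1 : NoMeet X M L1
    · have n2 : ¬ NoMeet X M L2 := fun n2 => bad_core h.1 hM h1 h2 h3 h12 h13 h23 n1 n2
      have n3 : ¬ NoMeet X M L3 := fun n3 => bad_core h.1 hM h1 h3 h2 h13 h12 h23.symm n1 n3
      exact ⟨M, L2, L3, hM, good _ h2 n2, good _ h3 n3, h2.ne_rem.symm, h3.ne_rem.symm, h23⟩
    · by_cases n2 : NoMeet X M L2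
      · have n3 : ¬ NoMeet X M L3 := fun n3 =>
          bad_core h.1 hM h2 h3 h1 h23 h12.symm h13.symm n2 n3
        exact ⟨M, L1, L3, hM, good _ h1 n1, good _ h3 n3, h1.ne_rem.symm, h3.ne_rem.symm, h13⟩
      · exact ⟨M, L1, L2, hM, good _ h1 n1, good _ h2 n2, h1.ne_rem.symm, h2.ne_rem.symm, h12⟩

/-- At most one bad line. -/
theorem GCM.good {n : ℕ} {X : Finset (ℝ × ℝ)} {M K K' : Set (ℝ × ℝ)} (h : GCM (n + 2) X)
    (hM : Mx (n + 2) X M) (hK : Mx (n + 1) (_root_.rem X M) K) (hno : NoMeet X M K)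
    (hK' : Mx (n + 1) (_root_.rem X M) K') (hne : K' ≠ K) :
    Mx (n + 2) X K' ∧ ∃ A ∈ X, A ∈ M ∧ A ∈ K' := by
  have hn : ¬ NoMeet X M K' := by
    intro hno'
    obtain ⟨L1, L2, L3, h1, h2, h3, h12, h13, h23⟩ := (h.rem hM).three
    have : ∃ L, Mx (n + 1) (_root_.rem X M) L ∧ K ≠ L ∧ K' ≠ L := by
      by_cases e1 : K ≠ L1 ∧ K' ≠ L1
      · exact ⟨L1, h1, e1⟩
      by_cases e2 : K ≠ L2 ∧ K' ≠ L2
      · exact ⟨L2, h2, e2⟩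
      refine ⟨L3, h3, ?_, ?_⟩ <;> grind
    obtain ⟨L, hL, e1, e2⟩ := this
    exact bad_core h.1 hM hK hK' hL hne.symm e1 e2 hno hno'
  unfold NoMeet at hn
  push Not at hn
  obtain ⟨A, hA, hAM, hAL⟩ := hn
  exact ⟨hK'.up hM.1 hA hAL hAM, A, hA, hAM, hAL⟩

/-! ### Configurations of maximal lines and bad lines -/

/-- `K` is a bad line for `M`. -/
def Bad (d : ℕ) (T : Finset (ℝ × ℝ)) (M K : Set (ℝ × ℝ)) : Prop :=
  Mx d (rem T M) K ∧ NoMeet T M K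

theorem Bad.ne {d : ℕ} {T : Finset (ℝ × ℝ)} {M K L : Set (ℝ × ℝ)} (h : GC (d + 1) T)
    (hM : Mx (d + 1) T M) (hL : Mx (d + 1) T L) (hb : Bad d T M K) : L ≠ K := by
  rintro rfl
  obtain ⟨A, hA, hAM, hAL⟩ := h.node hM hL
  exact hb.2 A hA hAM hAL

theorem Bad.down {d : ℕ} {T : Finset (ℝ × ℝ)} {M K L : Set (ℝ × ℝ)} (h : GC (d + 2) T)
    (hM : Mx (d + 2) T M) (hL : Mx (d + 2) T L) (hne : L ≠ M) (hb : Bad (d + 1) T M K) :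
    Bad d (rem T L) M K := by
  refine ⟨?_, fun A hA => hb.2 A (mem_rem.mp hA).1⟩
  rw [rem_comm]
  exact (h.rem hM).down (h.down hM hL hne) hb.1 (Bad.ne h hM hL hb).symm

/-- Configuration: `T` has degree `d + 1`, `Ls` are maximal lines and `Bs` are maximal lines
together with bad lines. -/
def H (d : ℕ) (T : Finset (ℝ × ℝ)) (Ls : List (Set (ℝ × ℝ)))
    (Bs : List (Set (ℝ × ℝ) × Set (ℝ × ℝ))) : Prop :=
  GCM (d + 1) T ∧ (∀ L ∈ Ls, Mx (d + 1) T L) ∧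
    (∀ p ∈ Bs, Mx (d + 1) T p.1 ∧ Bad d T p.1 p.2) ∧ (Ls ++ Bs.map Prod.fst).Nodup

section
variable {d : ℕ} {T : Finset (ℝ × ℝ)} {L L' M K M' K' : Set (ℝ × ℝ)} {Ls : List (Set (ℝ × ℝ))}
  {Bs : List (Set (ℝ × ℝ) × Set (ℝ × ℝ))}

theorem H.rem (h : H (d + 1) T (L :: Ls) Bs) : H d (rem T L) Ls Bs := by
  obtain ⟨h1, h2, h3, h4⟩ := h
  have hL := h2 L (by simp)
  simp only [List.cons_append, List.nodup_cons, List.mem_append, List.mem_map] at h4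
  refine ⟨h1.rem hL, fun N hN => ?_, fun p hp => ?_, h4.2⟩
  · exact h1.1.down hL (h2 N (by simp [hN])) (by rintro rfl; exact h4.1 (Or.inl hN))
  · have hne : p.1 ≠ L := by rintro rfl; exact h4.1 (Or.inr ⟨p, hp, rfl⟩)
    exact ⟨h1.1.down hL (h3 p hp).1 hne, Bad.down h1.1 (h3 p hp).1 hL hne.symm (h3 p hp).2⟩

theorem H.swap (h : H (d + 1) T Ls ((M, K) :: Bs)) : H d (_root_.rem T M) (K :: Ls) Bs := by
  obtain ⟨h1, h2, h3, h4⟩ := h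
  have hM := h3 (M, K) (by simp)
  have h4' : (M :: (Ls ++ Bs.map Prod.fst)).Nodup :=
    (List.perm_middle (l₁ := Ls) (a := M)).nodup_iff.mp (by simpa using h4)
  simp only [List.nodup_cons, List.mem_append, List.mem_map] at h4'
  refine ⟨h1.rem hM.1, fun N hN => ?_, fun p hp => ?_, ?_⟩
  · rw [List.mem_cons] at hN
    rcases hN with rfl | hN
    · exact hM.2.1
    · exact h1.1.down hM.1 (h2 N hN) (by rintro rfl; exact h4'.1 (Or.inl hN))
  · have hp' := h3 p (by simp [hp])
    have hne : p.1 ≠ M := by rintro rfl; exact h4'.1 (Or.inr ⟨p, hp, rfl⟩)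
    exact ⟨h1.1.down hM.1 hp'.1 hne, Bad.down h1.1 hp'.1 hM.1 hne.symm hp'.2⟩
  · simp only [List.cons_append, List.nodup_cons, List.mem_append, List.mem_map]
    refine ⟨?_, h4'.2⟩
    rintro (hK | ⟨p, hp, hpK⟩)
    · exact Bad.ne h1.1 hM.1 (h2 K hK) hM.2 rfl
    · exact Bad.ne h1.1 hM.1 (h3 p (by simp [hp])).1 hM.2 hpK

theorem H.perm {Ls' : List (Set (ℝ × ℝ))} {Bs' : List (Set (ℝ × ℝ) × Set (ℝ × ℝ))}
    (h : H d T Ls Bs) (h1 : Ls.Perm Ls') (h2 : Bs.Perm Bs') : H d T Ls' Bs' := by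
  refine ⟨h.1, fun L hL => h.2.1 L (h1.mem_iff.mpr hL), fun p hp => h.2.2.1 p (h2.mem_iff.mpr hp),
    (List.Perm.append h1 (h2.map _)).nodup_iff.mp h.2.2.2⟩

theorem H.b2 {a b : Set (ℝ × ℝ) × Set (ℝ × ℝ)} (h : H d T Ls (a :: b :: Bs)) :
    H d T Ls (b :: a :: Bs) :=
  h.perm (List.Perm.refl _) (List.Perm.swap _ _ _)

theorem H.b3 {a b c : Set (ℝ × ℝ) × Set (ℝ × ℝ)} (h : H d T Ls (a :: b :: c :: Bs)) :
    H d T Ls (c :: a :: b :: Bs) :=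
  h.perm (List.Perm.refl _) (List.perm_middle (l₁ := [a, b]))

theorem H.b4 {a b c e : Set (ℝ × ℝ) × Set (ℝ × ℝ)} (h : H d T Ls (a :: b :: c :: e :: Bs)) :
    H d T Ls (e :: a :: b :: c :: Bs) :=
  h.perm (List.Perm.refl _) (List.perm_middle (l₁ := [a, b, c]))

theorem H.l2 {a b : Set (ℝ × ℝ)} (h : H d T (a :: b :: Ls) Bs) :
    H d T (b :: a :: Ls) Bs :=
  h.perm (List.Perm.swap _ _ _) (List.Perm.refl _)

theorem H.l3 {a b c : Set (ℝ × ℝ)} (h : H d T (a :: b :: c :: Ls) Bs) :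
    H d T (c :: a :: b :: Ls) Bs :=
  h.perm (List.perm_middle (l₁ := [a, b])) (List.Perm.refl _)

theorem H.l4 {a b c e : Set (ℝ × ℝ)} (h : H d T (a :: b :: c :: e :: Ls) Bs) :
    H d T (e :: a :: b :: c :: Ls) Bs :=
  h.perm (List.perm_middle (l₁ := [a, b, c])) (List.Perm.refl _)

theorem H.forget (h : H d T Ls ((M, K) :: Bs)) : H d T (M :: Ls) Bs := by
  obtain ⟨h1, h2, h3, h4⟩ := h
  refine ⟨h1, fun N hN => ?_, fun p hp => h3 p (by simp [hp]), ?_⟩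
  · rw [List.mem_cons] at hN
    rcases hN with rfl | hN
    · exact (h3 (N, K) (by simp)).1
    · exact h2 N hN
  · exact (List.perm_middle (l₁ := Ls) (a := M)).nodup_iff.mp (by simpa using h4)

theorem H.add (h : H d T Ls Bs) (hL : Mx (d + 1) T L) (h1 : L ∉ Ls) (h2 : ∀ p ∈ Bs, p.1 ≠ L) :
    H d T (L :: Ls) Bs := by
  refine ⟨h.1, ?_, h.2.2.1, ?_⟩
  · simpa using ⟨hL, h.2.1⟩
  · simp only [List.cons_append, List.nodup_cons, List.mem_append, List.mem_map]
    refine ⟨?_, h.2.2.2⟩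
    rintro (h' | ⟨p, hp, hp'⟩)
    · exact h1 h'
    · exact h2 p hp hp'

theorem H.gc (h : H d T Ls Bs) : GC (d + 1) T := h.1.1

theorem H.mx (h : H d T (L :: Ls) Bs) : Mx (d + 1) T L := h.2.1 L (by simp)

theorem H.mxb (h : H d T Ls ((M, K) :: Bs)) : Mx (d + 1) T M := (h.2.2.1 (M, K) (by simp)).1

theorem H.bad (h : H d T Ls ((M, K) :: Bs)) : Bad d T M K := (h.2.2.1 (M, K) (by simp)).2

theorem H.zero (h : H 0 T (L :: Ls) Bs) : GC 0 (_root_.rem T L) := h.gc.rem h.mx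

theorem H.ne (h : H d T (L :: L' :: Ls) Bs) : L ≠ L' := by
  have := h.2.2.2
  simp only [List.cons_append, List.nodup_cons, List.mem_cons] at this
  tauto

theorem H.zero_mem (h : H 0 T (L :: L' :: Ls) Bs) {A : ℝ × ℝ} (hA : A ∈ T) (hAL : A ∉ L) :
    A ∈ L' := by
  obtain ⟨B, hB, hBL⟩ := (h.gc.down h.mx h.l2.mx h.ne.symm).nonempty
  rw [h.zero.zero_unique (A := A) (B := B) (by simp [hA, hAL]) hB]
  exact hBL

theorem H.zero_exists (h : H 0 T (L :: Ls) Bs) : ∃ A ∈ T, A ∉ L := by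
  obtain ⟨A, hA⟩ := h.zero.card_zero
  have : A ∈ _root_.rem T L := by rw [hA]; simp
  exact ⟨A, mem_rem.mp this⟩

theorem H.zero_eq (h : H 0 T (L :: Ls) Bs) {A B : ℝ × ℝ} (hA : A ∈ T) (hAL : A ∉ L) (hB : B ∈ T)
    (hBL : B ∉ L) : A = B :=
  h.zero.zero_unique (by simp [hA, hAL]) (by simp [hB, hBL])

theorem H.good (h : H (d + 1) T Ls ((M, K) :: Bs)) (hL : Mx (d + 1) (_root_.rem T M) L)
    (hne : L ≠ K) : Mx (d + 2) T L ∧ ∃ A ∈ T, A ∈ M ∧ A ∈ L :=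
  h.1.good h.mxb h.bad.1 h.bad.2 hL hne

/-- degree two: line through two nodes off `M`. -/
theorem H.good2 (h : H 1 T Ls ((M, K) :: Bs)) (hL : IsLn L) {u v : ℝ × ℝ}
    (hu : u ∈ T) (huM : u ∉ M) (hv : v ∈ T) (hvM : v ∉ M) (huv : u ≠ v) (huL : u ∈ L) (hvL : v ∈ L)
    (hne : L ≠ K) : Mx 2 T L ∧ ∃ A ∈ T, A ∈ M ∧ A ∈ L :=
  h.good ((h.gc.rem h.mxb).line_one hL (by simp [hu, huM]) (by simp [hv, hvM]) huv huL hvL) hne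

theorem H.cong {T' : Finset (ℝ × ℝ)} (h : H d T Ls Bs) (e : ∀ A, A ∈ T ↔ A ∈ T') :
    H d T' Ls Bs := by
  have : T = T' := Finset.ext e
  exact this ▸ h
end

/-! ### Four bad lines -/

theorem four_aux {T : Finset (ℝ × ℝ)} {M1 K1 M2 K2 : Set (ℝ × ℝ)}
    (h : H 1 T [] [(M1, K1), (M2, K2)]) :
    ∃ A1 A2 P L, IsLn L ∧ A1 ∈ L ∧ A2 ∈ L ∧ P ∈ L ∧ (A1 ∈ T ∧ A1 ∈ M1 ∧ A1 ∉ M2 ∧ A1 ∉ K2) ∧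
      (A2 ∈ T ∧ A2 ∈ M2 ∧ A2 ∉ M1 ∧ A2 ∉ K1) ∧ (P ∈ T ∧ P ∉ M1 ∧ P ∉ M2 ∧ P ∈ K1 ∧ P ∈ K2) := by
  have hs := h.swap
  have hs2 := h.b2.swap
  obtain ⟨P, hP, hPM⟩ := hs.forget.zero_exists
  have hP1 : P ∈ K1 := hs.forget.zero_mem hP hPM
  simp only [mem_rem] at hP
  have hP2 : P ∈ K2 := hs2.forget.zero_mem (by simp [hP, hPM]) hP.2
  obtain ⟨A2, hA2, hA2K⟩ := hs.zero_exists
  have hA2M : A2 ∈ M2 := hs.forget.l2.zero_mem hA2 hA2K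
  simp only [mem_rem] at hA2
  have hne : A2 ≠ P := by rintro rfl; exact hA2K hP1
  obtain ⟨L, hL, hAL, hPL⟩ := exists_line hne
  obtain ⟨hLm, w, hwT, hwM, hwL⟩ := h.good2 hL hA2.1 hA2.2 hP.1 hP.2 hne hAL hPL
    (by rintro rfl; exact hA2K hAL)
  have hf := h.forget.forget
  refine ⟨w, A2, P, L, hL, hwL, hAL, hPL, ⟨hwT, hwM, ?_, ?_⟩, ⟨hA2.1, hA2M, hA2.2, hA2K⟩,
    hP.1, hP.2, hPM, hP1, hP2⟩
  · exact h.gc.not_concurrent hLm hf.l2.mx hf.mx (by rintro rfl; exact hP.2 hPL)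
      (by rintro rfl; exact hPM hPL) hf.l2.ne hwL hwM
  · intro hwK
    have : L = K2 := hL.eq hs2.mx.1 (p := w) (q := P) (by rintro rfl; exact hP.2 hwM) hwL hPL hwK hP2
    exact h.b2.bad.2 A2 hA2.1 hA2M (this ▸ hAL)

theorem alg_rel {a b c a' b' c' : ℝ} {L K K' : Set (ℝ × ℝ)} (hL : IsLn L)
    (hK : ∀ p : ℝ × ℝ, p ∈ K ↔ a * p.1 + b * p.2 + c = 0)
    (hK' : ∀ p : ℝ × ℝ, p ∈ K' ↔ a' * p.1 + b' * p.2 + c' = 0)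
    {A B P : ℝ × ℝ} (hA : A ∈ L) (hB : B ∈ L) (hP : P ∈ L) (hPK : P ∈ K) (hPK' : P ∈ K')
    (hAK : A ∉ K) :
    (a * A.1 + b * A.2 + c) * (a' * B.1 + b' * B.2 + c') =
      (a * B.1 + b * B.2 + c) * (a' * A.1 + b' * A.2 + c') := by
  obtain ⟨l, m, n, hlm, hm⟩ := hL
  have hAP : A ≠ P := by rintro rfl; exact hAK hPK
  rw [hK] at hPK
  rw [hK'] at hPK'
  rw [hm] at hA hB hP
  set x := a * A.1 + b * A.2 + c with hx
  set x' := a' * A.1 + b' * A.2 + c' with hx'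
  have := line_sub (a' := x * a' - x' * a) (b' := x * b' - x' * b) (c' := x * c' - x' * c)
    hlm hAP hA hP (by linear_combination x * (-hx') - x' * (-hx)) 
    (by linear_combination x * hPK' - x' * hPK) hB
  linear_combination this

theorem alg_minor {k11 k12 k13 k14 k21 k22 k23 k24 k31 k32 k33 k34 k41 k42 k43 k44 : ℝ}
    (n11 : k11 ≠ 0) (n12 : k12 ≠ 0) (n13 : k13 ≠ 0) (n14 : k14 ≠ 0) (n21 : k21 ≠ 0)
    (n23 : k23 ≠ 0) (n24 : k24 ≠ 0) (n31 : k31 ≠ 0) (n34 : k34 ≠ 0) (n41 : k41 ≠ 0)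
    (r12 : k11 * k22 = k12 * k21) (r13 : k11 * k33 = k13 * k31) (r14 : k11 * k44 = k14 * k41)
    (r23 : k22 * k33 = k23 * k32) (r24 : k22 * k44 = k24 * k42) (r34 : k33 * k44 = k34 * k43)
    (hdet : Matrix.det !![k11, k12, k13, k14; k21, k22, k23, k24; k31, k32, k33, k34;
      k41, k42, k43, k44] = 0) :
    Matrix.det !![k11, k12, k13; k21, k22, k23; k31, k32, k33] = 0 ∨
    Matrix.det !![k11, k12, k14; k21, k22, k24; k41, k42, k44] = 0 ∨
    Matrix.det !![k11, k13, k14; k31, k33, k34; k41, k43, k44] = 0 ∨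
    Matrix.det !![k22, k23, k24; k32, k33, k34; k42, k43, k44] = 0 := by
  have e22 : k22 = k21 * k12 / k11 := by field_simp; linarith
  have e33 : k33 = k31 * k13 / k11 := by field_simp; linarith
  have e44 : k44 = k41 * k14 / k11 := by field_simp; linarith
  obtain ⟨u, e23⟩ : ∃ u, k23 = u * k21 * k13 / k11 := ⟨k23 * k11 / (k21 * k13), by field_simp⟩
  obtain ⟨v, e24⟩ : ∃ u, k24 = u * k21 * k14 / k11 := ⟨k24 * k11 / (k21 * k14), by field_simp⟩
  obtain ⟨w, e34⟩ : ∃ u, k34 = u * k31 * k14 / k11 := ⟨k34 * k11 / (k31 * k14), by field_simp⟩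
  have hu : u ≠ 0 := by rintro rfl; apply n23; rw [e23]; simp
  have hv : v ≠ 0 := by rintro rfl; apply n24; rw [e24]; simp
  have hw : w ≠ 0 := by rintro rfl; apply n34; rw [e34]; simp
  have e32 : k32 = k31 * k12 / (u * k11) := by
    have : k32 = k22 * k33 / k23 := by field_simp; linarith
    rw [this, e22, e33, e23]; field_simp
  have e42 : k42 = k41 * k12 / (v * k11) := by
    have : k42 = k22 * k44 / k24 := by field_simp; linarith
    rw [this, e22, e44, e24]; field_simp
  have e43 : k43 = k41 * k13 / (w * k11) := by
    have : k43 = k33 * k44 / k34 := by field_simp; linarith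
    rw [this, e33, e44, e34]; field_simp
  clear r12 r13 r14 r23 r24 r34 n23 n24 n34
  subst e22 e33 e44 e23 e24 e34 e32 e42 e43
  have key : (u - 1) * (v - 1) * (w - 1) * (v - u * w) = 0 := by
    have h2 : (u - 1) * (v - 1) * (w - 1) * (v - u * w) =
      Matrix.det !![k11, k12, k13, k14;
      k21, k21 * k12 / k11, u * k21 * k13 / k11, v * k21 * k14 / k11;
      k31, k31 * k12 / (u * k11), k31 * k13 / k11, w * k31 * k14 / k11;
      k41, k41 * k12 / (v * k11), k41 * k13 / (w * k11), k41 * k14 / k11] *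
      (u * v * w * k11 ^ 2 / (k12 * k13 * k14 * k21 * k31 * k41)) := by
      simp [Matrix.det_succ_row_zero, Fin.sum_univ_succ, Fin.succAbove]
      field_simp
      ring
    rw [h2, hdet, zero_mul]
  rw [mul_eq_zero, mul_eq_zero, mul_eq_zero] at key
  rcases key with ((h | h) | h) | h
  · left
    have : u = 1 := by linarith
    subst this
    simp [Matrix.det_fin_three]
    field_simp
    ring
  · right; left
    have : v = 1 := by linarith
    subst this
    simp [Matrix.det_fin_three]
    field_simp
    ring
  · right; right; left
    have : w = 1 := by linarith
    subst this
    simp [Matrix.det_fin_three]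
    field_simp
    ring
  · right; right; right
    have : v = u * w := by linarith
    subst this
    simp [Matrix.det_fin_three]
    field_simp
    ring

/-- rank argument -/
theorem det_affine (a b c : Fin 4 → ℝ) (A : Fin 4 → ℝ × ℝ) :
    Matrix.det (Matrix.of fun i j : Fin 4 => a i * (A j).1 + b i * (A j).2 + c i) = 0 := by
  simp [Matrix.det_succ_row_zero, Fin.sum_univ_succ, Fin.succAbove]
  ring

theorem minor_ne {a1 b1 c1 a2 b2 c2 a3 b3 c3 : ℝ} {K1 K2 K3 : Set (ℝ × ℝ)}
    (ab1 : a1 ≠ 0 ∨ b1 ≠ 0)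
    (h1 : ∀ p : ℝ × ℝ, p ∈ K1 ↔ a1 * p.1 + b1 * p.2 + c1 = 0)
    (ab2 : a2 ≠ 0 ∨ b2 ≠ 0)
    (h2 : ∀ p : ℝ × ℝ, p ∈ K2 ↔ a2 * p.1 + b2 * p.2 + c2 = 0)
    (h3 : ∀ p : ℝ × ℝ, p ∈ K3 ↔ a3 * p.1 + b3 * p.2 + c3 = 0)
    {P12 P13 A1 A2 A3 : ℝ × ℝ} {L12 L13 : Set (ℝ × ℝ)}
    (l12 : IsLn L12) (l13 : IsLn L13) (hK12 : K1 ≠ K2)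
    (hP1 : P12 ∈ K1) (hP2 : P12 ∈ K2) (hP3 : P12 ∉ K3) (hR1 : P13 ∈ K1) (hR3 : P13 ∈ K3)
    (hA1 : A1 ∉ K1) (hA12 : A1 ≠ A2) (hA13 : A1 ≠ A3)
    (m1 : A1 ∈ L12) (m2 : A2 ∈ L12) (m3 : P12 ∈ L12)
    (m1' : A1 ∈ L13) (m2' : A3 ∈ L13) (m3' : P13 ∈ L13) :
    Matrix.det !![a1 * A1.1 + b1 * A1.2 + c1, a1 * A2.1 + b1 * A2.2 + c1,
      a1 * A3.1 + b1 * A3.2 + c1; a2 * A1.1 + b2 * A1.2 + c2, a2 * A2.1 + b2 * A2.2 + c2,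
      a2 * A3.1 + b2 * A3.2 + c2; a3 * A1.1 + b3 * A1.2 + c3, a3 * A2.1 + b3 * A2.2 + c3,
      a3 * A3.1 + b3 * A3.2 + c3] ≠ 0 := by
  intro hdet
  have hprod : (a1 * (b2 * c3 - c2 * b3) - b1 * (a2 * c3 - c2 * a3) + c1 * (a2 * b3 - b2 * a3)) *
      (A1.1 * (A2.2 - A3.2) - A1.2 * (A2.1 - A3.1) + (A2.1 * A3.2 - A2.2 * A3.1)) = 0 := by
    rw [← hdet]
    simp [Matrix.det_fin_three]
    ring
  have q1 := (h1 _).mp hP1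
  have q2 := (h2 _).mp hP2
  have q3 : a3 * P12.1 + b3 * P12.2 + c3 ≠ 0 := fun h => hP3 ((h3 _).mpr h)
  rcases mul_eq_zero.mp hprod with hh | hh
  · have hd : (a1 * b2 - b1 * a2) * (a3 * P12.1 + b3 * P12.2 + c3) = 0 := by
      linear_combination hh + (a3 * b2 - b3 * a2) * q1 + (b3 * a1 - a3 * b1) * q2
    have hd' : a1 * b2 - b1 * a2 = 0 := (mul_eq_zero.mp hd).resolve_right q3
    apply hK12
    refine IsLn.eq ⟨a1, b1, c1, ab1, h1⟩ ⟨a2, b2, c2, ab2, h2⟩ (p := P12)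
      (q := (P12.1 + b1, P12.2 - a1)) ?_ hP1 ?_ hP2 ?_
    · intro he
      have e1 := congrArg Prod.fst he
      have e2 := congrArg Prod.snd he
      simp at e1 e2
      rcases ab1 with h | h
      · exact h (by linarith)
      · exact h (by linarith)
    · rw [h1]
      simp only
      linear_combination q1
    · rw [h2]
      simp only
      linear_combination q2 - hd'
  · have hL : L12 = L13 := by
      obtain ⟨l, m, n, hlm, hm⟩ := l13
      have k1 := (hm _).mp m1'
      have k3 := (hm _).mp m2'
      refine IsLn.eq l12 ⟨l, m, n, hlm, hm⟩ hA12 m1 m2 m1' ?_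
      rw [hm]
      by_contra hcon
      have := line_sub (a := A1.2 - A3.2) (b := A3.1 - A1.1) (c := A1.1 * A3.2 - A1.2 * A3.1)
        (a' := l) (b' := m) (c' := n) (p := A1) (q := A3) (r := A2) (by
          by_contra h0
          push Not at h0
          apply hA13
          ext <;> linarith [h0.1, h0.2]) hA13 (by ring) (by ring) k1 k3
          (by linear_combination -hh)
      exact hcon this
    have hPP : P12 ≠ P13 := by rintro rfl; exact hP3 hR3
    have : L12 = K1 := IsLn.eq l12 ⟨a1, b1, c1, ab1, h1⟩ hPP m3 (hL ▸ m3') hP1 hR1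
    exact hA1 (this ▸ m1)

set_option maxHeartbeats 1000000 in
theorem no_four {X : Finset (ℝ × ℝ)} {M1 K1 M2 K2 M3 K3 M4 K4 : Set (ℝ × ℝ)}
    (h : H 5 X [] [(M1, K1), (M2, K2), (M3, K3), (M4, K4)]) : False := by
  have key : ∀ {M1 K1 M2 K2 M3 K3 M4 K4 : Set (ℝ × ℝ)},
      H 5 X [] [(M1, K1), (M2, K2), (M3, K3), (M4, K4)] →
      (∀ A B : ℝ × ℝ, (A ∈ X ∧ A ∉ M2 ∧ A ∉ M3 ∧ A ∉ M4 ∧ A ∉ K2 ∧ A ∉ K3 ∧ A ∉ K4) →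
        (B ∈ X ∧ B ∉ M2 ∧ B ∉ M3 ∧ B ∉ M4 ∧ B ∉ K2 ∧ B ∉ K3 ∧ B ∉ K4) → A = B) ∧
      (IsLn K1 ∧ K1 ≠ K2) ∧
      ∃ A1 A2 P L, IsLn L ∧ A1 ∈ L ∧ A2 ∈ L ∧ P ∈ L ∧
        (A1 ∈ X ∧ A1 ∉ M2 ∧ A1 ∉ M3 ∧ A1 ∉ M4 ∧ A1 ∉ K2 ∧ A1 ∉ K3 ∧ A1 ∉ K4) ∧
        (A2 ∈ X ∧ A2 ∉ M1 ∧ A2 ∉ M3 ∧ A2 ∉ M4 ∧ A2 ∉ K1 ∧ A2 ∉ K3 ∧ A2 ∉ K4) ∧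
        A1 ∈ M1 ∧ A2 ∈ M2 ∧ A1 ∉ K1 ∧ A2 ∉ K2 ∧
        P ∈ K1 ∧ P ∈ K2 ∧ P ∉ K3 ∧ P ∉ K4 := by
    intro M1 K1 M2 K2 M3 K3 M4 K4 h
    have h34 := h.b4.swap.b3.swap
    have hT := h34.rem.rem
    refine ⟨fun A B hA hB => ?_, ⟨h34.swap.swap.l2.mx.1, h34.swap.swap.l2.ne⟩, ?_⟩
    · exact hT.b2.swap.zero_eq (A := A) (B := B) (by simp only [mem_rem]; tauto) (by tauto)
        (by simp only [mem_rem]; tauto) (by tauto)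
    · obtain ⟨A1, A2, P, L, hL, h1, h2, h3, hA1, hA2, hP⟩ := four_aux hT
      have b1 := hT.bad.2 A1 hA1.1 hA1.2.1
      have b2 := hT.b2.bad.2 A2 hA2.1 hA2.2.1
      simp only [mem_rem] at hA1 hA2 hP
      exact ⟨A1, A2, P, L, hL, h1, h2, h3, by tauto, by tauto, by tauto, by tauto, b1, b2,
        by tauto, by tauto, by tauto, by tauto⟩
  obtain ⟨u1, ⟨ln1, n12⟩, A1, A2, P12, L12, l12, x12, y12, z12, ⟨f1_0, f1_1, f1_2, f1_3, f1_4, f1_5, f1_6⟩, ⟨g1_0, g1_1, g1_2, g1_3, g1_4, g1_5, g1_6⟩, q1_0, q1_1, q1_2, q1_3, q1_4, q1_5, q1_6, q1_7⟩ := key h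
  obtain ⟨-, ⟨-, n13⟩, A1', A3, P13, L13, l13, x13, y13, z13, ⟨f2_0, f2_1, f2_2, f2_3, f2_4, f2_5, f2_6⟩, ⟨g2_0, g2_1, g2_2, g2_3, g2_4, g2_5, g2_6⟩, q2_0, q2_1, q2_2, q2_3, q2_4, q2_5, q2_6, q2_7⟩ := key h.b3.b2
  obtain ⟨-, ⟨-, n14⟩, A1'', A4, P14, L14, l14, x14, y14, z14, ⟨f3_0, f3_1, f3_2, f3_3, f3_4, f3_5, f3_6⟩, ⟨g3_0, g3_1, g3_2, g3_3, g3_4, g3_5, g3_6⟩, q3_0, q3_1, q3_2, q3_3, q3_4, q3_5, q3_6, q3_7⟩ := key h.b4.b2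
  obtain ⟨u2, ⟨ln2, n23⟩, A2', A3', P23, L23, l23, x23, y23, z23, ⟨f4_0, f4_1, f4_2, f4_3, f4_4, f4_5, f4_6⟩, ⟨g4_0, g4_1, g4_2, g4_3, g4_4, g4_5, g4_6⟩, q4_0, q4_1, q4_2, q4_3, q4_4, q4_5, q4_6, q4_7⟩ := key h.b3.b3
  obtain ⟨-, ⟨-, n24⟩, A2'', A4', P24, L24, l24, x24, y24, z24, ⟨f5_0, f5_1, f5_2, f5_3, f5_4, f5_5, f5_6⟩, ⟨g5_0, g5_1, g5_2, g5_3, g5_4, g5_5, g5_6⟩, q5_0, q5_1, q5_2, q5_3, q5_4, q5_5, q5_6, q5_7⟩ := key h.b4.b3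
  obtain ⟨u3, ⟨ln3, n34⟩, A3'', A4'', P34, L34, l34, x34, y34, z34, ⟨f6_0, f6_1, f6_2, f6_3, f6_4, f6_5, f6_6⟩, ⟨g6_0, g6_1, g6_2, g6_3, g6_4, g6_5, g6_6⟩, q6_0, q6_1, q6_2, q6_3, q6_4, q6_5, q6_6, q6_7⟩ := key h.b4.b4
  obtain ⟨u4, ⟨ln4, -⟩, -⟩ := key h.b4
  obtain rfl : A1 = A1' := u1 _ _ (by refine ⟨?_, ?_, ?_, ?_, ?_, ?_, ?_⟩ <;> assumption)
    (by refine ⟨?_, ?_, ?_, ?_, ?_, ?_, ?_⟩ <;> assumption)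
  obtain rfl : A1 = A1'' := u1 _ _ (by refine ⟨?_, ?_, ?_, ?_, ?_, ?_, ?_⟩ <;> assumption)
    (by refine ⟨?_, ?_, ?_, ?_, ?_, ?_, ?_⟩ <;> assumption)
  obtain rfl : A2 = A2' := u2 _ _ (by refine ⟨?_, ?_, ?_, ?_, ?_, ?_, ?_⟩ <;> assumption)
    (by refine ⟨?_, ?_, ?_, ?_, ?_, ?_, ?_⟩ <;> assumption)
  obtain rfl : A2 = A2'' := u2 _ _ (by refine ⟨?_, ?_, ?_, ?_, ?_, ?_, ?_⟩ <;> assumption)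
    (by refine ⟨?_, ?_, ?_, ?_, ?_, ?_, ?_⟩ <;> assumption)
  obtain rfl : A3 = A3' := u3 _ _ (by refine ⟨?_, ?_, ?_, ?_, ?_, ?_, ?_⟩ <;> assumption)
    (by refine ⟨?_, ?_, ?_, ?_, ?_, ?_, ?_⟩ <;> assumption)
  obtain rfl : A3 = A3'' := u3 _ _ (by refine ⟨?_, ?_, ?_, ?_, ?_, ?_, ?_⟩ <;> assumption)
    (by refine ⟨?_, ?_, ?_, ?_, ?_, ?_, ?_⟩ <;> assumption)
  obtain rfl : A4 = A4' := u4 _ _ (by refine ⟨?_, ?_, ?_, ?_, ?_, ?_, ?_⟩ <;> assumption)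
    (by refine ⟨?_, ?_, ?_, ?_, ?_, ?_, ?_⟩ <;> assumption)
  obtain rfl : A4 = A4'' := u4 _ _ (by refine ⟨?_, ?_, ?_, ?_, ?_, ?_, ?_⟩ <;> assumption)
    (by refine ⟨?_, ?_, ?_, ?_, ?_, ?_, ?_⟩ <;> assumption)
  clear key u1 u2 u3 u4
  have hA12 : A1 ≠ A2 := by rintro rfl; contradiction
  have hA13 : A1 ≠ A3 := by rintro rfl; contradiction
  have hA14 : A1 ≠ A4 := by rintro rfl; contradiction
  have hA23 : A2 ≠ A3 := by rintro rfl; contradiction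
  have hA24 : A2 ≠ A4 := by rintro rfl; contradiction
  have hA34 : A3 ≠ A4 := by rintro rfl; contradiction
  obtain ⟨a1, b1, c1, ab1, h1⟩ := ln1
  obtain ⟨a2, b2, c2, ab2, h2⟩ := ln2
  obtain ⟨a3, b3, c3, ab3, h3⟩ := ln3
  obtain ⟨a4, b4, c4, ab4, h4⟩ := ln4
  have hdet := det_affine ![a1, a2, a3, a4] ![b1, b2, b3, b4] ![c1, c2, c3, c4] ![A1, A2, A3, A4]
  have := alg_minor (k11 := a1 * A1.1 + b1 * A1.2 + c1) (k12 := a1 * A2.1 + b1 * A2.2 + c1)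
    (k13 := a1 * A3.1 + b1 * A3.2 + c1) (k14 := a1 * A4.1 + b1 * A4.2 + c1)
    (k21 := a2 * A1.1 + b2 * A1.2 + c2) (k22 := a2 * A2.1 + b2 * A2.2 + c2)
    (k23 := a2 * A3.1 + b2 * A3.2 + c2) (k24 := a2 * A4.1 + b2 * A4.2 + c2)
    (k31 := a3 * A1.1 + b3 * A1.2 + c3) (k32 := a3 * A2.1 + b3 * A2.2 + c3)
    (k33 := a3 * A3.1 + b3 * A3.2 + c3) (k34 := a3 * A4.1 + b3 * A4.2 + c3)
    (k41 := a4 * A1.1 + b4 * A1.2 + c4) (k42 := a4 * A2.1 + b4 * A2.2 + c4)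
    (k43 := a4 * A3.1 + b4 * A3.2 + c4) (k44 := a4 * A4.1 + b4 * A4.2 + c4)
    (by rw [Ne, ← h1]; assumption) (by rw [Ne, ← h1]; assumption) (by rw [Ne, ← h1]; assumption)
    (by rw [Ne, ← h1]; assumption) (by rw [Ne, ← h2]; assumption) (by rw [Ne, ← h2]; assumption)
    (by rw [Ne, ← h2]; assumption) (by rw [Ne, ← h3]; assumption) (by rw [Ne, ← h3]; assumption)
    (by rw [Ne, ← h4]; assumption)
    (alg_rel l12 h1 h2 x12 y12 z12 (by assumption) (by assumption) (by assumption))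
    (alg_rel l13 h1 h3 x13 y13 z13 (by assumption) (by assumption) (by assumption))
    (alg_rel l14 h1 h4 x14 y14 z14 (by assumption) (by assumption) (by assumption))
    (alg_rel l23 h2 h3 x23 y23 z23 (by assumption) (by assumption) (by assumption))
    (alg_rel l24 h2 h4 x24 y24 z24 (by assumption) (by assumption) (by assumption))
    (alg_rel l34 h3 h4 x34 y34 z34 (by assumption) (by assumption) (by assumption))
    (by
      rw [← hdet]
      congr 1
      ext i j
      fin_cases i <;> fin_cases j <;> rfl)
  rcases this with h | h | h | h
  · exact minor_ne ab1 h1 ab2 h2 h3 l12 l13 n12 (by assumption) (by assumption) (by assumption) (by assumption)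
      (by assumption) (by assumption) hA12 hA13 x12 y12 z12 x13 y13 z13 h
  · exact minor_ne ab1 h1 ab2 h2 h4 l12 l14 n12 (by assumption) (by assumption) (by assumption) (by assumption)
      (by assumption) (by assumption) hA12 hA14 x12 y12 z12 x14 y14 z14 h
  · exact minor_ne ab1 h1 ab3 h3 h4 l13 l14 n13 (by assumption) (by assumption) (by assumption) (by assumption)
      (by assumption) (by assumption) hA13 hA14 x13 y13 z13 x14 y14 z14 h
  · exact minor_ne ab2 h2 ab3 h3 h4 l23 l24 n23 (by assumption) (by assumption) (by assumption) (by assumption)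
      (by assumption) (by assumption) hA23 hA24 x23 y23 z23 x24 y24 z24 h

/-! ### Three bad lines -/

theorem three_core {X : Finset (ℝ × ℝ)} {M1 K1 M2 K2 M3 K3 M4 : Set (ℝ × ℝ)}
    (h : H 5 X [M4] [(M1, K1), (M2, K2), (M3, K3)]) {Q1 Q2 Q3 A4 : ℝ × ℝ}
    (hQ1 : Q1 ∈ X ∧ Q1 ∉ M1 ∧ Q1 ∉ M2 ∧ Q1 ∉ M3 ∧ Q1 ∉ M4 ∧ Q1 ∈ K1 ∧ Q1 ∉ K2 ∧ Q1 ∉ K3)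
    (hQ2 : Q2 ∈ X ∧ Q2 ∉ M1 ∧ Q2 ∉ M2 ∧ Q2 ∉ M3 ∧ Q2 ∉ M4 ∧ Q2 ∉ K1 ∧ Q2 ∈ K2 ∧ Q2 ∉ K3)
    (hQ3 : Q3 ∈ X ∧ Q3 ∉ M1 ∧ Q3 ∉ M2 ∧ Q3 ∉ M3 ∧ Q3 ∉ M4 ∧ Q3 ∉ K1 ∧ Q3 ∉ K2 ∧ Q3 ∈ K3)
    (hA4 : A4 ∈ X ∧ A4 ∉ M1 ∧ A4 ∉ M2 ∧ A4 ∉ M3 ∧ A4 ∉ K1 ∧ A4 ∉ K2 ∧ A4 ∉ K3)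
    (hnc : ∀ L, IsLn L → Q1 ∈ L → Q2 ∈ L → Q3 ∉ L) :
    ∃ L, IsLn L ∧ A4 ∈ L ∧ Q1 ∈ L ∧ (Q2 ∈ L ∨ Q3 ∈ L) := by
  have h12 : Q1 ≠ Q2 := by rintro rfl; tauto
  have h13 : Q1 ≠ Q3 := by rintro rfl; tauto
  obtain ⟨L2, l2, x2, y2⟩ := exists_line h12
  obtain ⟨L3, l3, x3, y3⟩ := exists_line h13
  have hne : L2 ≠ L3 := by rintro rfl; exact hnc _ l2 x2 y2 y3
  -- the set of degree four with lines `K3, K2` and pair `(M1, K1)`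
  have hs := h.rem.b2.swap.b2.swap
  have hV := hs.rem
  have hV' := hs.l2.rem
  have g2 := (hV.good2 l2 (u := Q1) (v := Q2) (by simp only [mem_rem]; tauto) (by tauto)
    (by simp only [mem_rem]; tauto) (by tauto) h12 x2 y2 (by rintro rfl; tauto)).1
  have g3 := (hV'.good2 l3 (u := Q1) (v := Q3) (by simp only [mem_rem]; tauto) (by tauto)
    (by simp only [mem_rem]; tauto) (by tauto) h13 x3 y3 (by rintro rfl; tauto)).1
  have d2 := hV.gc.down hV.mx g2 (by rintro rfl; tauto)
  have d3 := hV'.gc.down hV'.mx g3 (by rintro rfl; tauto)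
  -- the degree two set
  have hT := h.b2.swap.b2.swap.rem.rem
  set T := rem (rem (rem (rem X M2) M3) K3) K2 with hTdef
  have e2 : rem (rem (rem (rem (rem X M4) M2) M3) K3) K2 = rem T M4 := by
    ext A; simp only [hTdef, mem_rem]; tauto
  have e3 : rem (rem (rem (rem (rem X M4) M2) M3) K2) K3 = rem T M4 := by
    ext A; simp only [hTdef, mem_rem]; tauto
  rw [e2] at d2
  rw [e3] at d3
  have fin : ∀ L, IsLn L → Q1 ∈ L → L ≠ K1 → Mx 2 T L → (∃ z ∈ T, z ∈ M4 ∧ z ∈ L) → A4 ∈ L := by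
    rintro L hL hQ hK hm ⟨z, hz, hz4, hzL⟩
    have hz1 : z ∉ M1 := hT.gc.not_concurrent hm hT.mx hT.mxb (by rintro rfl; tauto)
      (by rintro rfl; tauto) hT.forget.l2.ne hzL hz4
    have hzK : z ∉ K1 := by
      intro hzK
      exact hK (hL.eq hT.swap.mx.1 (p := z) (q := Q1) (by rintro rfl; tauto) hzL hQ hzK
        (by tauto))
    have : A4 = z := hT.swap.zero_eq (A := A4) (B := z) (by simp only [hTdef, mem_rem]; tauto)
      (by tauto) (by simp [hz, hz1]) hzK
    rw [this]
    exact hzL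
  by_cases hno : NoMeet T M4 L2
  · obtain ⟨g, hz⟩ := hT.1.good hT.mx d2 hno d3 hne.symm
    exact ⟨L3, l3, fin L3 l3 x3 (by rintro rfl; tauto) g hz, x3, Or.inr y3⟩
  · unfold NoMeet at hno
    push Not at hno
    obtain ⟨z, hz, hz4, hzL⟩ := hno
    exact ⟨L2, l2, fin L2 l2 x2 (by rintro rfl; tauto) (d2.up hT.mx.1 hz hzL hz4)
      ⟨z, hz, hz4, hzL⟩, x2, Or.inl y2⟩

theorem no_three {X : Finset (ℝ × ℝ)} {M1 K1 M2 K2 M3 K3 M4 : Set (ℝ × ℝ)}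
    (h : H 5 X [M4] [(M1, K1), (M2, K2), (M3, K3)])
    (h4 : ∀ L, Mx 5 (rem X M4) L → Mx 6 X L)
    (hall : ∀ L, Mx 6 X L → L = M1 ∨ L = M2 ∨ L = M3 ∨ L = M4) : False := by
  have hX4 := h.rem
  have hZ := hX4.swap.swap.swap
  set Z := rem (rem (rem (rem X M4) M1) M2) M3 with hZdef
  -- lines [K3, K2, K1]
  obtain ⟨Q1, hq1, hq1'⟩ := hZ.rem.zero_exists
  have hq11 := hZ.rem.zero_mem hq1 hq1'
  obtain ⟨Q2, hq2, hq2'⟩ := hZ.l3.rem.zero_exists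
  have hq22 := hZ.l3.rem.zero_mem hq2 hq2'
  obtain ⟨Q3, hq3, hq3'⟩ := hZ.l3.rem.l2.zero_exists
  simp only [mem_rem] at hq1 hq2 hq3
  have hq33 := hZ.l2.rem.l2.zero_mem (A := Q3) (by simp only [mem_rem]; tauto) (by tauto)
  -- swap roles
  have hA := h.swap.swap.swap
  obtain ⟨A4, ha, ha'⟩ := hA.rem.rem.zero_exists
  have ha4 := hA.rem.rem.zero_mem ha ha'
  simp only [hZdef, mem_rem] at hq1 hq2 hq3 ha
  have hQ1 : Q1 ∈ X ∧ Q1 ∉ M1 ∧ Q1 ∉ M2 ∧ Q1 ∉ M3 ∧ Q1 ∉ M4 ∧ Q1 ∈ K1 ∧ Q1 ∉ K2 ∧ Q1 ∉ K3 := by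
    tauto
  have hQ2 : Q2 ∈ X ∧ Q2 ∉ M1 ∧ Q2 ∉ M2 ∧ Q2 ∉ M3 ∧ Q2 ∉ M4 ∧ Q2 ∉ K1 ∧ Q2 ∈ K2 ∧ Q2 ∉ K3 := by
    tauto
  have hQ3 : Q3 ∈ X ∧ Q3 ∉ M1 ∧ Q3 ∉ M2 ∧ Q3 ∉ M3 ∧ Q3 ∉ M4 ∧ Q3 ∉ K1 ∧ Q3 ∉ K2 ∧ Q3 ∈ K3 := by
    tauto
  have hA4 : A4 ∈ X ∧ A4 ∉ M1 ∧ A4 ∉ M2 ∧ A4 ∉ M3 ∧ A4 ∉ K1 ∧ A4 ∉ K2 ∧ A4 ∉ K3 := by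
    tauto
  clear hq1 hq2 hq3 hq11 hq22 hq33 hq1' hq2' hq3' ha ha'
  have h12 : Q1 ≠ Q2 := by rintro rfl; tauto
  have hnc : ∀ L, IsLn L → Q1 ∈ L → Q2 ∈ L → Q3 ∉ L := by
    intro L hL m1 m2 m3
    have c1 : Mx 1 (rem Z K3) L := hZ.rem.gc.line_one hL (u := Q1) (v := Q2)
      (by simp only [hZdef, mem_rem]; tauto) (by simp only [hZdef, mem_rem]; tauto) h12 m1 m2
    have c2 : Mx 2 Z L := c1.up hZ.mx.1 (A := Q3) (by simp only [hZdef, mem_rem]; tauto) m3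
      (by tauto)
    have c3 := (hX4.swap.swap.good c2 (by rintro rfl; tauto)).1
    have c4 := (hX4.swap.good c3 (by rintro rfl; tauto)).1
    have c5 := (hX4.good c4 (by rintro rfl; tauto)).1
    rcases hall L (h4 L c5) with rfl | rfl | rfl | rfl <;> tauto
  have r1 := three_core h hQ1 hQ2 hQ3 hA4 hnc
  have r2 := three_core h.b2 (Q1 := Q2) (Q2 := Q1) (Q3 := Q3) (A4 := A4) (by tauto) (by tauto)
    (by tauto) (by tauto) (fun L hL a b => hnc L hL b a)
  have r3 := three_core h.b3 (Q1 := Q3) (Q2 := Q1) (Q3 := Q2) (A4 := A4) (by tauto) (by tauto)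
    (by tauto) (by tauto) (fun L hL a b c => hnc L hL b c a)
  have two : ∀ L L' Q, IsLn L → IsLn L' → A4 ∈ L → A4 ∈ L' → Q ∈ L → Q ∈ L' → Q ∉ M4 → L = L' :=
    fun L L' Q hL hL' a a' q q' hQ => hL.eq hL' (p := A4) (q := Q)
      (by rintro rfl; exact hQ ha4) a q a' q'
  obtain ⟨L1, l1, a1, b1, c1⟩ := r1
  obtain ⟨L2, l2, a2, b2, c2⟩ := r2
  obtain ⟨L3, l3, a3, b3, c3⟩ := r3
  have n1 := hQ1.2.2.2.2.1
  have n2 := hQ2.2.2.2.2.1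
  have n3 := hQ3.2.2.2.2.1
  rcases c1 with c1 | c1
  · obtain rfl : L1 = L2 := two _ _ _ l1 l2 a1 a2 c1 b2 n2
    rcases c3 with c3 | c3
    · obtain rfl : L1 = L3 := two _ _ _ l1 l3 a1 a3 b1 c3 n1
      exact hnc _ l1 b1 c1 b3
    · obtain rfl : L1 = L3 := two _ _ _ l1 l3 a1 a3 c1 c3 n2
      exact hnc _ l1 b1 c1 b3
  · obtain rfl : L1 = L3 := two _ _ _ l1 l3 a1 a3 c1 b3 n3
    rcases c2 with c2 | c2
    · obtain rfl : L1 = L2 := two _ _ _ l1 l2 a1 a2 b1 c2 n1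
      exact hnc _ l1 b1 b2 c1
    · obtain rfl : L1 = L2 := two _ _ _ l1 l2 a1 a2 c1 c2 n3
      exact hnc _ l1 b1 b2 c1

/-! ### Two bad lines -/

theorem H.addB {d : ℕ} {T : Finset (ℝ × ℝ)} {M K : Set (ℝ × ℝ)} {Ls : List (Set (ℝ × ℝ))}
    {Bs : List (Set (ℝ × ℝ) × Set (ℝ × ℝ))} (h : H d T (M :: Ls) Bs) (hb : Bad d T M K) :
    H d T Ls ((M, K) :: Bs) := by
  refine ⟨h.1, fun L hL => h.2.1 L (by simp [hL]), fun p hp => ?_, ?_⟩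
  · rw [List.mem_cons] at hp
    rcases hp with rfl | hp
    · exact ⟨h.mx, hb⟩
    · exact h.2.2.1 p hp
  · have := (List.perm_middle (l₁ := Ls) (l₂ := Bs.map Prod.fst) (a := M)).nodup_iff.mpr h.2.2.2
    simpa using this

theorem two_aux1 {X : Finset (ℝ × ℝ)} {M1 K1 M2 K2 M3 M4 K L1 : Set (ℝ × ℝ)}
    (h : H 4 (rem X M4) [] [(M3, K), (M1, K1), (M2, K2)]) {Q1 Q : ℝ × ℝ}
    (hQ1 : Q1 ∈ X ∧ Q1 ∉ M1 ∧ Q1 ∉ M2 ∧ Q1 ∉ M3 ∧ Q1 ∉ M4 ∧ Q1 ∈ K1 ∧ Q1 ∉ K2 ∧ Q1 ∉ K)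
    (hQ : Q ∈ X ∧ Q ∉ M1 ∧ Q ∉ M2 ∧ Q ∉ M3 ∧ Q ∉ M4 ∧ Q ∉ K1 ∧ Q ∉ K2 ∧ Q ∈ K)
    (l1 : IsLn L1) (m1 : Q1 ∈ L1) (m : Q ∈ L1) :
    H 1 (rem (rem (rem (rem X M4) M2) K2) L1) [] [(M3, K), (M1, K1)] := by
  have hW := h.b3.swap.rem
  have hne : Q1 ≠ Q := by rintro rfl; tauto
  have g1 := (hW.b2.forget.rem.good2 l1 (u := Q1) (v := Q) (by simp only [mem_rem]; tauto)
    (by tauto) (by simp only [mem_rem]; tauto) (by tauto) hne m1 m (by rintro rfl; tauto)).1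
  have g2 := (hW.b2.good g1 (by rintro rfl; tauto)).1
  refine (hW.add g2 (by simp) ?_).rem
  intro p hp
  simp only [List.mem_cons, List.not_mem_nil, or_false] at hp
  rcases hp with rfl | rfl
  · rintro rfl; tauto
  · rintro rfl; tauto

theorem two_aux2 {X : Finset (ℝ × ℝ)} {M1 K1 M2 K2 M3 M4 K L1 L2 N : Set (ℝ × ℝ)}
    (h : H 4 (rem X M4) [] [(M3, K), (M1, K1), (M2, K2)]) {Q1 Q2 Q R a : ℝ × ℝ}
    (hT : H 1 (rem (rem (rem (rem X M4) M2) K2) L1) [] [(M3, K), (M1, K1)])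
    (hQ2 : Q2 ∈ X ∧ Q2 ∉ M1 ∧ Q2 ∉ M2 ∧ Q2 ∉ M3 ∧ Q2 ∉ M4 ∧ Q2 ∉ K1 ∧ Q2 ∈ K2 ∧ Q2 ∉ K)
    (hQ : Q ∈ X ∧ Q ∉ M1 ∧ Q ∉ M2 ∧ Q ∉ M3 ∧ Q ∉ M4 ∧ Q ∉ K1 ∧ Q ∉ K2 ∧ Q ∈ K)
    (hR : R ∈ X ∧ R ∉ M1 ∧ R ∉ M2 ∧ R ∉ M3 ∧ R ∉ M4 ∧ R ∈ K1 ∧ R ∉ K2 ∧ R ∈ K ∧ R ∉ L1)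
    (ha : a ∈ X ∧ a ∈ M1 ∧ a ∉ M2 ∧ a ∉ M3 ∧ a ∉ M4 ∧ a ∉ K2 ∧ a ∉ K ∧ a ∉ L1)
    (l1 : IsLn L1) (m1 : Q1 ∈ L1) (m : Q ∈ L1)
    (l2 : IsLn L2) (m2 : Q2 ∈ L2) (m' : Q ∈ L2) (hN : IsLn N) (haN : a ∈ N) (hRN : R ∈ N)
    (hnc : ∀ L, IsLn L → Q1 ∈ L → Q2 ∈ L → Q ∉ L) :
    ∃ y, y ∈ M3 ∧ y ∉ M4 ∧ y ∈ L2 ∧ y ∈ N := by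
  have hne : Q2 ≠ Q := by rintro rfl; tauto
  have hY := h.b2.swap.rem.b2.forget.rem
  obtain ⟨-, y, hy, hy3, hyL⟩ := hY.good2 l2 (u := Q2) (v := Q) (by simp only [mem_rem]; tauto)
    (by tauto) (by simp only [mem_rem]; tauto) (by tauto) hne m2 m' (by rintro rfl; tauto)
  simp only [mem_rem] at hy
  have hyK2 : y ∉ K2 := by
    intro hyK
    have : L2 = K2 := l2.eq h.b3.swap.mx.1 (p := y) (q := Q2) (by rintro rfl; tauto) hyL m2 hyK
      (by tauto)
    rw [this] at m'
    tauto
  have hyL1 : y ∉ L1 := by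
    intro hyL1
    have : L1 = L2 := l1.eq l2 (p := y) (q := Q) (by rintro rfl; tauto) hyL1 m hyL m'
    exact hnc _ l1 m1 (this ▸ m2) m
  refine ⟨y, hy3, by tauto, hyL, ?_⟩
  have haR : a ≠ R := by rintro rfl; tauto
  obtain ⟨hNm, w, hw, hw3, hwN⟩ := hT.good2 hN (u := a) (v := R) (by simp only [mem_rem]; tauto)
    (by tauto) (by simp only [mem_rem]; tauto) (by tauto) haR haN hRN (by rintro rfl; tauto)
  have hw1 : w ∉ M1 := hT.gc.not_concurrent hNm hT.mxb hT.b2.mxb (by rintro rfl; tauto)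
    (by rintro rfl; tauto) hT.forget.forget.l2.ne hwN hw3
  have hwK : w ∉ K1 := by
    intro hwK
    have : N = K1 := hN.eq h.b2.swap.mx.1 (p := w) (q := R) (by rintro rfl; tauto) hwN hRN hwK
      (by tauto)
    exact h.b2.bad.2 a (by simp only [mem_rem]; tauto) (by tauto) (this ▸ haN)
  have : y = w := hT.b2.swap.zero_eq (A := y) (B := w) (by simp only [mem_rem]; tauto) (by tauto)
    (by rw [mem_rem]; exact ⟨hw, hw1⟩) hwK
  rw [this]
  exact hwN

theorem no_two {X : Finset (ℝ × ℝ)} {M1 K1 M2 K2 M3 M4 : Set (ℝ × ℝ)}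
    (h : H 5 X [M3, M4] [(M1, K1), (M2, K2)])
    (h3 : ∀ L, Mx 5 (rem X M3) L → Mx 6 X L)
    (h4 : ∀ L, Mx 5 (rem X M4) L → Mx 6 X L)
    (hall : ∀ L, Mx 6 X L → L = M1 ∨ L = M2 ∨ L = M3 ∨ L = M4) : False := by
  obtain ⟨K, hK, hK1, hK2⟩ : ∃ K, Mx 4 (rem (rem X M3) M4) K ∧ K ≠ M1 ∧ K ≠ M2 := by
    obtain ⟨A, B, C, hA, hB, hC, hAB, hAC, hBC⟩ := h.rem.rem.1.three
    by_cases eA : A ≠ M1 ∧ A ≠ M2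
    · exact ⟨A, hA, eA⟩
    by_cases eB : B ≠ M1 ∧ B ≠ M2
    · exact ⟨B, hB, eB⟩
    refine ⟨C, hC, ?_, ?_⟩ <;> grind
  have hK' : Mx 4 (rem (rem X M4) M3) K := by rw [rem_comm]; exact hK
  have hnX : ¬ Mx 6 X K := by
    intro hm
    rcases hall K hm with e | e | e | e
    · exact hK1 e
    · exact hK2 e
    · exact hK'.ne_rem e
    · exact hK.ne_rem e
  have H3 : H 4 (rem X M3) [] [(M4, K), (M1, K1), (M2, K2)] := by
    refine h.rem.addB ⟨hK, fun A hA hA4 hAK => ?_⟩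
    exact hnX (h3 K (hK.up h.l2.mx.1 hA hAK hA4))
  have H4 : H 4 (rem X M4) [] [(M3, K), (M1, K1), (M2, K2)] := by
    refine h.l2.rem.addB ⟨hK', fun A hA hA4 hAK => ?_⟩
    exact hnX (h4 K (hK'.up h.mx.1 hA hAK hA4))
  have hZ := H3.swap.swap.swap
  set Z := rem (rem (rem (rem X M3) M4) M1) M2 with hZdef
  -- lines [K2, K1, K]
  obtain ⟨Q1, hq1, hq1'⟩ := hZ.rem.l2.zero_exists
  have hq11 := hZ.rem.l2.zero_mem hq1 hq1'
  obtain ⟨Q2, hq2, hq2'⟩ := hZ.l3.rem.l2.zero_exists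
  have hq22 := hZ.l3.rem.l2.zero_mem hq2 hq2'
  obtain ⟨Q, hq, hq'⟩ := hZ.rem.zero_exists
  have hqq := hZ.rem.zero_mem hq hq'
  obtain ⟨R, hr, hr1, hr2⟩ := hZ.rem.gc.node hZ.rem.mx hZ.rem.l2.mx
  simp only [hZdef, mem_rem] at hq1 hq2 hq hr
  have hQ1 : Q1 ∈ X ∧ Q1 ∉ M1 ∧ Q1 ∉ M2 ∧ Q1 ∉ M3 ∧ Q1 ∉ M4 ∧ Q1 ∈ K1 ∧ Q1 ∉ K2 ∧ Q1 ∉ K := by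
    tauto
  have hQ2 : Q2 ∈ X ∧ Q2 ∉ M1 ∧ Q2 ∉ M2 ∧ Q2 ∉ M3 ∧ Q2 ∉ M4 ∧ Q2 ∉ K1 ∧ Q2 ∈ K2 ∧ Q2 ∉ K := by
    tauto
  have hQ : Q ∈ X ∧ Q ∉ M1 ∧ Q ∉ M2 ∧ Q ∉ M3 ∧ Q ∉ M4 ∧ Q ∉ K1 ∧ Q ∉ K2 ∧ Q ∈ K := by
    tauto
  clear hq1 hq2 hq hq11 hq22 hqq hq1' hq2' hq'
  have h1Q : Q1 ≠ Q := by rintro rfl; tauto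
  have h2Q : Q2 ≠ Q := by rintro rfl; tauto
  have hnc : ∀ L, IsLn L → Q1 ∈ L → Q2 ∈ L → Q ∉ L := by
    intro L hL m1 m2 m3
    have c1 : Mx 1 (rem Z K2) L := hZ.rem.gc.line_one hL (u := Q1) (v := Q)
      (by simp only [hZdef, mem_rem]; tauto) (by simp only [hZdef, mem_rem]; tauto) h1Q m1 m3
    have c2 : Mx 2 Z L := c1.up hZ.mx.1 (A := Q2) (by simp only [hZdef, mem_rem]; tauto) m2
      (by tauto)
    have c3 := (H3.swap.swap.good c2 (by rintro rfl; tauto)).1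
    have c4 := (H3.swap.good c3 (by rintro rfl; tauto)).1
    have c5 := (H3.good c4 (by rintro rfl; tauto)).1
    rcases hall L (h3 L c5) with rfl | rfl | rfl | rfl <;> tauto
  obtain ⟨L1, l1, m1, m⟩ := exists_line h1Q
  obtain ⟨L2, l2, m2, m'⟩ := exists_line h2Q
  have hRL : R ∉ L1 := by
    intro hRL
    have : L1 = K1 := l1.eq H3.b2.swap.mx.1 (p := R) (q := Q1) (by rintro rfl; tauto) hRL m1 hr1
      (by tauto)
    rw [this] at m
    tauto
  have hR : R ∈ X ∧ R ∉ M1 ∧ R ∉ M2 ∧ R ∉ M3 ∧ R ∉ M4 ∧ R ∈ K1 ∧ R ∉ K2 ∧ R ∈ K ∧ R ∉ L1 := by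
    tauto
  clear hr hr1 hr2 hRL
  have T3 := two_aux1 H4 hQ1 hQ l1 m1 m
  have T4 := two_aux1 H3 (by tauto) (by tauto) l1 m1 m
  obtain ⟨a, ha, ha'⟩ := T3.swap.zero_exists
  have ha1 := T3.swap.forget.l2.zero_mem ha ha'
  simp only [mem_rem] at ha
  have hA : a ∈ X ∧ a ∈ M1 ∧ a ∉ M2 ∧ a ∉ M3 ∧ a ∉ M4 ∧ a ∉ K2 ∧ a ∉ K ∧ a ∉ L1 := by tauto
  have haR : a ≠ R := by rintro rfl; tauto
  obtain ⟨N, hN, haN, hRN⟩ := exists_line haR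
  obtain ⟨y3, y33, y34, y3L, y3N⟩ := two_aux2 H4 T3 hQ2 hQ hR hA l1 m1 m l2 m2 m' hN haN hRN hnc
  obtain ⟨y4, y44, y43, y4L, y4N⟩ := two_aux2 H3 T4 (Q1 := Q1) (Q2 := Q2) (Q := Q) (by tauto)
    (by tauto) (by tauto) (by tauto) l1 m1 m l2 m2 m' hN haN hRN hnc
  have e1 : L2 = N := l2.eq hN (p := y3) (q := y4) (by rintro rfl; tauto) y3L y4L y3N y4N
  have e2 : L2 = K := l2.eq hK.1 (p := R) (q := Q) (by rintro rfl; tauto) (e1 ▸ hRN) m'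
    (by tauto) (by tauto)
  rw [e2] at m2
  tauto

/-! ### At most one bad line among four -/

theorem few_aux {n : ℕ} {X : Finset (ℝ × ℝ)} {M1 M2 M3 M4 : Set (ℝ × ℝ)}
    (h : H (n + 3) X [M1, M2, M3, M4] [])
    (h1 : ∀ L, Mx (n + 3) (rem X M1) L → Mx (n + 4) X L)
    (h2 : ∀ L, Mx (n + 3) (rem X M2) L → Mx (n + 4) X L)
    (hall : ∀ L, Mx (n + 4) X L → L = M1 ∨ L = M2 ∨ L = M3 ∨ L = M4) :
    ∃ K, Bad (n + 2) (rem X M1) M2 K ∧ Bad (n + 2) (rem X M2) M1 K ∧ K ≠ M3 := by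
  obtain ⟨K, hK, hK1, hK2⟩ : ∃ K, Mx (n + 2) (rem (rem X M1) M2) K ∧ K ≠ M3 ∧ K ≠ M4 := by
    obtain ⟨A, B, C, hA, hB, hC, hAB, hAC, hBC⟩ := h.rem.rem.1.three
    by_cases eA : A ≠ M3 ∧ A ≠ M4
    · exact ⟨A, hA, eA⟩
    by_cases eB : B ≠ M3 ∧ B ≠ M4
    · exact ⟨B, hB, eB⟩
    refine ⟨C, hC, ?_, ?_⟩ <;> grind
  have hK' : Mx (n + 2) (rem (rem X M2) M1) K := by rw [rem_comm]; exact hK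
  have hnX : ¬ Mx (n + 4) X K := by
    intro hm
    rcases hall K hm with e | e | e | e
    · exact hK'.ne_rem e
    · exact hK.ne_rem e
    · exact hK1 e
    · exact hK2 e
  refine ⟨K, ⟨hK, fun A hA hA4 hAK => ?_⟩, ⟨hK', fun A hA hA4 hAK => ?_⟩, hK1⟩
  · exact hnX (h1 K (hK.up h.l2.mx.1 hA hAK hA4))
  · exact hnX (h2 K (hK'.up h.mx.1 hA hAK hA4))

theorem no_few {n : ℕ} {X : Finset (ℝ × ℝ)} {M1 M2 M3 M4 : Set (ℝ × ℝ)}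
    (h : H (n + 3) X [M1, M2, M3, M4] [])
    (h1 : ∀ L, Mx (n + 3) (rem X M1) L → Mx (n + 4) X L)
    (h2 : ∀ L, Mx (n + 3) (rem X M2) L → Mx (n + 4) X L)
    (h3 : ∀ L, Mx (n + 3) (rem X M3) L → Mx (n + 4) X L)
    (hall : ∀ L, Mx (n + 4) X L → L = M1 ∨ L = M2 ∨ L = M3 ∨ L = M4) : False := by
  obtain ⟨K13, a1, a3, aM2⟩ := few_aux (M3 := M2) (M4 := M4) h.l3.l2 h1 h3 (fun L hL => by
    have := hall L hL; tauto)
  obtain ⟨K23, b2, b3, bM1⟩ := few_aux (M3 := M1) (M4 := M4) h.l3.l3 h2 h3 (fun L hL => by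
    have := hall L hL; tauto)
  -- in `X \ M1 \ M2`, both lines are bad for `M3`
  have hA := Bad.down h.rem.gc h.rem.l2.mx h.rem.mx h.rem.ne a1
  have hB := Bad.down h.l2.rem.gc h.l2.rem.l2.mx h.l2.rem.mx h.l2.rem.ne b2
  rw [rem_comm] at hB
  have hne : K23 ≠ K13 := by
    rintro rfl
    obtain ⟨A, hA, hA2, hAK⟩ := (h.l3.rem.l2.gc.rem h.l3.rem.mx).node
      (h.l3.rem.gc.down h.l3.rem.mx h.l3.rem.l2.mx h.l3.rem.ne.symm) a3.1
    exact b3.2 A (mem_rem.mp hA).1 hA2 hAK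
  obtain ⟨-, A, hA', hA3, hAK⟩ := h.rem.rem.1.good h.rem.rem.mx hA.1 hA.2 hB.1 hne
  exact hB.2 A hA' hA3 hAK


/-! ### Counting maximal lines -/

/-- The set of maximal lines. -/
def SM (n : ℕ) (X : Finset (ℝ × ℝ)) : Set (Set (ℝ × ℝ)) := {L | Mx n X L}

theorem mem_SM {n : ℕ} {X : Finset (ℝ × ℝ)} {L : Set (ℝ × ℝ)} : L ∈ SM n X ↔ Mx n X L := Iff.rfl

theorem mu_eq (n : ℕ) (X : Finset (ℝ × ℝ)) : mu n X = (SM n X).ncard := by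
  unfold mu
  congr 1
  ext L
  constructor
  · rintro ⟨p, hp, rfl⟩
    exact mx_iff hp
  · intro h
    exact Mx.exists h

theorem SM_finite (n : ℕ) (X : Finset (ℝ × ℝ)) : (SM (n + 1) X).Finite := by
  refine Set.Finite.of_finite_image (f := fun L => onL X L)
    (X.powerset.finite_toSet.subset ?_) ?_
  · rintro _ ⟨L, hL, rfl⟩
    simp only [Finset.coe_powerset, Set.mem_preimage, Set.mem_powerset_iff]
    intro A hA
    exact (mem_onL.mp hA).1
  · intro L hL L' hL' he
    have hc : 1 < (onL X L).card := by rw [hL.2]; omega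
    obtain ⟨a, ha, b, hb, hab⟩ := Finset.one_lt_card.mp hc
    have he' : onL X L = onL X L' := he
    have ha' := he' ▸ ha
    have hb' := he' ▸ hb
    exact hL.1.eq hL'.1 hab (mem_onL.mp ha).2 (mem_onL.mp hb).2 (mem_onL.mp ha').2
      (mem_onL.mp hb').2

theorem three_le {n : ℕ} {X : Finset (ℝ × ℝ)} (h : GCM (n + 1) X) : 3 ≤ (SM (n + 1) X).ncard := by
  obtain ⟨A, B, C, hA, hB, hC, h1, h2, h3⟩ := h.three
  have : ({A, B, C} : Set (Set (ℝ × ℝ))).ncard = 3 := Set.ncard_eq_three.mpr ⟨A, B, C, h1, h2, h3, rfl⟩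
  rw [← this]
  refine Set.ncard_le_ncard ?_ (SM_finite n X)
  rintro L (rfl | rfl | rfl) <;> assumption

theorem le_add {n : ℕ} {X : Finset (ℝ × ℝ)} (h : GCM (n + 1) X) :
    (SM (n + 1) X).ncard ≤ n + 3 := by
  obtain ⟨M, hM⟩ := h.exists_mx
  have hn : ∀ L, ∃ A, Mx (n + 1) X L → A ∈ X ∧ A ∈ M ∧ A ∈ L := by
    intro L
    by_cases hL : Mx (n + 1) X L
    · obtain ⟨A, hA⟩ := h.1.node hM hL
      exact ⟨A, fun _ => hA⟩
    · exact ⟨0, fun h => absurd h hL⟩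
  choose f hf using hn
  have h1 : (SM (n + 1) X \ {M}).ncard ≤ ((onL X M : Finset (ℝ × ℝ)) : Set (ℝ × ℝ)).ncard := by
    refine Set.ncard_le_ncard_of_injOn f ?_ ?_ (Finset.finite_toSet _)
    · rintro L ⟨hL, _⟩
      have := hf L hL
      simp [this.1, this.2.1]
    · rintro L ⟨hL, hLM⟩ L' ⟨hL', hLM'⟩ he
      by_contra hne
      have a := hf L hL
      have b := hf L' hL'
      rw [← he] at b
      exact h.1.not_concurrent hL hL' hM hne hLM hLM' a.2.2 b.2.2 a.2.1
  rw [Set.ncard_coe_finset, hM.2] at h1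
  have h2 := Set.ncard_sdiff_singleton_add_one (s := SM (n + 1) X) (a := M) hM (SM_finite n X)
  omega

theorem bad_or {n : ℕ} {X : Finset (ℝ × ℝ)} {M : Set (ℝ × ℝ)} (hM : Mx (n + 1) X M) :
    (∃ K, Bad n X M K) ∨ ∀ L, Mx n (rem X M) L → Mx (n + 1) X L := by
  by_cases hb : ∃ K, Bad n X M K
  · exact Or.inl hb
  · right
    intro L hL
    by_contra hc
    refine hb ⟨L, hL, fun A hA hAM hAL => hc (hL.up hM.1 hA hAL hAM)⟩

theorem count_bad {n : ℕ} {X : Finset (ℝ × ℝ)} {M K : Set (ℝ × ℝ)} (h : GCM (n + 2) X)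
    (hM : Mx (n + 2) X M) (hb : Bad (n + 1) X M K) :
    (SM (n + 1) (rem X M)).ncard = (SM (n + 2) X).ncard := by
  have he : SM (n + 1) (rem X M) = insert K (SM (n + 2) X \ {M}) := by
    ext L
    simp only [Set.mem_insert_iff, Set.mem_sdiff, Set.mem_singleton_iff, mem_SM]
    constructor
    · intro hL
      by_cases hK : L = K
      · exact Or.inl hK
      · exact Or.inr ⟨(h.good hM hb.1 hb.2 hL hK).1, hL.ne_rem⟩
    · rintro (rfl | ⟨hL, hne⟩)
      · exact hb.1
      · exact h.1.down hM hL hne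
  have h2 := Set.ncard_sdiff_singleton_add_one (s := SM (n + 2) X) (a := M) hM (SM_finite (n + 1) X)
  have h3 : (SM (n + 2) X \ {M}).Finite := (SM_finite (n + 1) X).subset Set.sdiff_subset
  rw [he, Set.ncard_insert_of_notMem ?_ h3, h2]
  rintro ⟨hK, _⟩
  exact Bad.ne h.1 hM hK hb rfl

theorem count_good {n : ℕ} {X : Finset (ℝ × ℝ)} {M : Set (ℝ × ℝ)} (h : GCM (n + 2) X)
    (hM : Mx (n + 2) X M) (hg : ∀ L, Mx (n + 1) (rem X M) L → Mx (n + 2) X L) :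
    (SM (n + 1) (rem X M)).ncard + 1 = (SM (n + 2) X).ncard := by
  have he : SM (n + 1) (rem X M) = SM (n + 2) X \ {M} := by
    ext L
    simp only [Set.mem_sdiff, Set.mem_singleton_iff, mem_SM]
    constructor
    · intro hL
      exact ⟨hg L hL, hL.ne_rem⟩
    · rintro ⟨hL, hne⟩
      exact h.1.down hM hL hne
  rw [he]
  exact Set.ncard_sdiff_singleton_add_one (s := SM (n + 2) X) (a := M) hM (SM_finite (n + 1) X)

theorem all_bad {n : ℕ} : ∀ (Bs : List (Set (ℝ × ℝ) × Set (ℝ × ℝ))) (d : ℕ)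
    (X : Finset (ℝ × ℝ)) (Ls : List (Set (ℝ × ℝ))), H d X Ls Bs → d = n + Bs.length →
    (SM (d + 1) X).ncard ≤ n + 3 := by
  intro Bs
  induction Bs with
  | nil =>
    intro d X Ls h hd
    simp only [List.length_nil, add_zero] at hd
    subst hd
    exact le_add h.1
  | cons p Bs ih =>
    intro d X Ls h hd
    obtain ⟨M, K⟩ := p
    simp only [List.length_cons] at hd
    obtain ⟨e, rfl⟩ : ∃ e, d = e + 1 := ⟨n + Bs.length, by omega⟩
    have := ih e _ _ h.swap (by omega)
    rw [count_bad h.1 h.mxb h.bad] at this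
    exact this

theorem six_four {X : Finset (ℝ × ℝ)} {M1 M2 M3 M4 : Set (ℝ × ℝ)}
    (h : H 5 X [M1, M2, M3, M4] [])
    (hall : ∀ L, Mx 6 X L → L = M1 ∨ L = M2 ∨ L = M3 ∨ L = M4) : False := by
  rcases bad_or h.mx with ⟨K1, b1⟩ | g1 <;> rcases bad_or h.l2.mx with ⟨K2, b2⟩ | g2 <;>
    rcases bad_or h.l3.mx with ⟨K3, b3⟩ | g3 <;> rcases bad_or h.l4.mx with ⟨K4, b4⟩ | g4
  · exact no_four ((((h.addB b1).addB b2).addB b3).addB b4)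
  · exact no_three (((h.addB b1).addB b2).addB b3) g4 (fun L hL => by have := hall L hL; tauto)
  · exact no_three (((h.addB b1).addB b2).l2.addB b4) g3 (fun L hL => by have := hall L hL; tauto)
  · exact no_two ((h.addB b1).addB b2) g3 g4 (fun L hL => by have := hall L hL; tauto)
  · exact no_three (((h.addB b1).l2.addB b3).l2.addB b4) g2
      (fun L hL => by have := hall L hL; tauto)
  · exact no_two ((h.addB b1).l2.addB b3) g2 g4 (fun L hL => by have := hall L hL; tauto)
  · exact no_two ((h.addB b1).l3.addB b4) g2 g3 (fun L hL => by have := hall L hL; tauto)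
  · exact no_few h.l4.l4.l4 g2 g3 g4 (fun L hL => by have := hall L hL; tauto)
  · exact no_three ((h.l2.addB b2).l2.addB b3 |>.l2.addB b4) g1
      (fun L hL => by have := hall L hL; tauto)
  · exact no_two ((h.l2.addB b2).l2.addB b3) g1 g4 (fun L hL => by have := hall L hL; tauto)
  · exact no_two ((h.l2.addB b2).l3.addB b4) g1 g3 (fun L hL => by have := hall L hL; tauto)
  · exact no_few (M4 := M2) (h.perm (List.Perm.cons M1 (List.perm_middle (l₁ := [M3, M4])).symm)
      (List.Perm.refl _)) g1 g3 g4 (fun L hL => by have := hall L hL; tauto)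
  · exact no_two ((h.l3.addB b3).l3.addB b4) g1 g2 (fun L hL => by have := hall L hL; tauto)
  · exact no_few (M4 := M3) (h.perm ((List.Perm.swap M4 M3 []).cons M2 |>.cons M1)
      (List.Perm.refl _)) g1 g2 g4 (fun L hL => by have := hall L hL; tauto)
  · exact no_few h g1 g2 g3 hall
  · exact no_few h g1 g2 g3 hall

theorem gap {n : ℕ} : ∀ {X : Finset (ℝ × ℝ)}, GCM (n + 1) X →
    ¬ (4 ≤ (SM (n + 1) X).ncard ∧ (SM (n + 1) X).ncard + 2 ≤ n + 1) := by
  induction n with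
  | zero => intro X _; omega
  | succ n ih =>
    rintro X h ⟨h4, hle⟩
    have key : ∀ M, Mx (n + 2) X M →
        ((∃ K, Bad (n + 1) X M K) ∧ (SM (n + 2) X).ncard = n) ∨
        ((∀ L, Mx (n + 1) (rem X M) L → Mx (n + 2) X L) ∧ (SM (n + 2) X).ncard = 4) := by
      intro M hM
      have := ih (h.rem hM)
      rcases bad_or hM with ⟨K, hb⟩ | hg
      · left
        refine ⟨⟨K, hb⟩, ?_⟩
        rw [count_bad h hM hb] at this
        have h4' : 4 ≤ (SM (n + 2) X).ncard := h4
        have hle' : (SM (n + 2) X).ncard + 2 ≤ n + 1 + 1 := hle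
        omega
      · right
        refine ⟨hg, ?_⟩
        have hc := count_good h hM hg
        have h4' : 4 ≤ (SM (n + 2) X).ncard := h4
        have hle' : (SM (n + 2) X).ncard + 2 ≤ n + 1 + 1 := hle
        omega
    by_cases e4 : (SM (n + 2) X).ncard = 4
    · obtain ⟨M1, M2, M3, M4, h12, h13, h14, h23, h24, h34, he⟩ := Set.ncard_eq_four.mp e4
      have hmem : ∀ L, Mx (n + 2) X L ↔ L = M1 ∨ L = M2 ∨ L = M3 ∨ L = M4 := by
        intro L
        rw [← mem_SM, he]
        simp
      have hH : H (n + 1) X [M1, M2, M3, M4] [] := by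
        refine ⟨h, ?_, by simp, ?_⟩
        · intro L hL
          rw [hmem]
          simpa using hL
        · simp [h12, h13, h14, h23, h24, h34]
      have hn : 4 ≤ n := by
        have hle' : (SM (n + 2) X).ncard + 2 ≤ n + 1 + 1 := hle
        omega
      by_cases hn4 : n = 4
      · subst hn4
        exact six_four hH (fun L hL => (hmem L).mp hL)
      · have hgood : ∀ M, Mx (n + 2) X M → ∀ L, Mx (n + 1) (rem X M) L → Mx (n + 2) X L := by
          intro M hM
          rcases key M hM with ⟨_, hk⟩ | ⟨hk, _⟩
          · omega
          · exact hk
        obtain ⟨m, rfl⟩ : ∃ m, n = m + 2 := ⟨n - 2, by omega⟩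
        exact no_few hH (hgood M1 hH.mx) (hgood M2 hH.l2.mx) (hgood M3 hH.l3.mx)
          (fun L hL => (hmem L).mp hL)
    · have hbad : ∀ M, ∃ K, Mx (n + 2) X M → Bad (n + 1) X M K := by
        intro M
        by_cases hM : Mx (n + 2) X M
        · rcases key M hM with ⟨⟨K, hK⟩, _⟩ | ⟨_, hk⟩
          · exact ⟨K, fun _ => hK⟩
          · exact absurd hk e4
        · exact ⟨M, fun h => absurd h hM⟩
      choose K hK using hbad
      have h4' : 4 ≤ (SM (n + 2) X).ncard := h4
      have hn : (SM (n + 2) X).ncard = n := by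
        obtain ⟨M, hM⟩ := h.exists_mx
        rcases key M hM with ⟨_, hk⟩ | ⟨_, hk⟩
        · exact hk
        · exact absurd hk e4
      obtain ⟨t, ht, htc⟩ := Set.exists_subset_card_eq (s := SM (n + 2) X) (n := 5) (by omega)
      have htf : t.Finite := (SM_finite (n + 1) X).subset ht
      have hl : htf.toFinset.toList.length = 5 := by
        rw [Finset.length_toList, ← htc, Set.ncard_eq_toFinset_card t htf]
      have hH : H (n + 1) X [] (htf.toFinset.toList.map (fun L => (L, K L))) := by
        refine ⟨h, by simp, ?_, ?_⟩
        · intro p hp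
          simp only [List.mem_map, Finset.mem_toList, Set.Finite.mem_toFinset] at hp
          obtain ⟨L, hL, rfl⟩ := hp
          exact ⟨ht hL, hK L (ht hL)⟩
        · simp only [List.map_map, List.nil_append, Function.comp_def, List.map_id']
          exact Finset.nodup_toList _
      have := all_bad (n := n - 4) _ _ _ _ hH (by rw [List.length_map, hl]; omega)
      have h' : (SM (n + 2) X).ncard ≤ n - 4 + 3 := this
      omega

theorem SM_zero {X : Finset (ℝ × ℝ)} (h : GC 0 X) : (SM 0 X).ncard = 0 := by
  obtain ⟨A, rfl⟩ := h.card_zero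
  refine Set.Infinite.ncard ?_
  have hex : ∀ t : ℝ, ∃ L, IsLn L ∧ A ∈ L ∧ (A.1 + 1, A.2 + t) ∈ L := by
    intro t
    have hne : A ≠ (A.1 + 1, A.2 + t) := by
      intro e
      have := congrArg Prod.fst e
      simp at this
    exact exists_line hne
  choose f hf using hex
  refine Set.infinite_of_injective_forall_mem (f := f) ?_ ?_
  · intro s t hst
    by_contra hne
    have h1 := hf s
    have h2 := hf t
    rw [← hst] at h2
    obtain ⟨a, b, c, hab, hL⟩ := h1.1
    have e0 := h1.2.1
    have e1 := h1.2.2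
    have e2 := h2.2.2
    simp only [hL] at e0 e1 e2
    have hb : b * (s - t) = 0 := by linear_combination e1 - e2
    have hb' : b = 0 := by
      rcases mul_eq_zero.mp hb with hb | hb
      · exact hb
      · exact absurd (sub_eq_zero.mp hb) hne
    subst hb'
    have ha : a = 0 := by linear_combination e1 - e0
    simp [ha] at hab
  · intro t
    refine ⟨(hf t).1, ?_⟩
    have : onL {A} (f t) = {A} := by
      ext B
      simp only [mem_onL, Finset.mem_singleton]
      constructor
      · exact fun h => h.1
      · rintro rfl
        exact ⟨rfl, (hf t).2.1⟩
    rw [this]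
    simp


/-- Assuming GM up to degree `n`, for any `GC_n` set `X` we have
`μ(X) ∈ {3, n-1, n, n+1, n+2}`. -/
theorem stmt_19 (n : ℕ) (hGM : ∀ m ≤ n, GM m)
    (X : Finset (ℝ × ℝ)) (hX : IsGC n X) :
    mu n X ∈ ({3, n - 1, n, n + 1, n + 2} : Set ℕ) := by
  have hg := gc_of_isGC hX
  rw [mu_eq]
  cases n with
  | zero =>
    rw [SM_zero hg]
    simp
  | succ n =>
    have h : GCM (n + 1) X := ⟨hg, hGM⟩
    have h1 := three_le h
    have h2 := le_add h
    have h3 := gap h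
    simp only [Set.mem_insert_iff, Set.mem_singleton_iff]
    omega
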